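/- Define x_f := (H_f⁻¹)^ · Ŝ_{{2f+1,…,n}} · Ê_f · Ĥ_f ∈ A for 0 ≤ f ≤ ⌊n/2⌋, where H_f⁻¹ = {d⁻¹ : d ∈ H_f(n)} and S_{{2f+1,…,n}} is the subgroup of S_n of permutations fixing 1,…,2f pointwise. Assume rq^{2n−2f−2} − q⁻¹ ≠ 0 for all 1 ≤ f ≤ ⌊n/2⌋, and define c_0 := 1 and c_f := −((q^{4f−3} − q^{2f−3})/(rq^{2n−2f−2} − q⁻¹)) · c_{f−1} for 1 ≤ f ≤ ⌊n/2⌋. Then the element x := Σ_{f=0}^{⌊n/2⌋} c_f x_f satisfies x·E_i = 0 and x·T_i = q·x for all i = 1,…,n−1 (so x is, up to a scalar, the symmetrizer of the BMW algebra). -/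

import Mathlib

open Finset
open scoped Pointwise

namespace BMWPaper

/-- The Coxeter length of a permutation of `Fin n`: the number of inversions. -/
def len {n : ℕ} (w : Equiv.Perm (Fin n)) : ℕ :=
  (Finset.univ.filter (fun p : Fin n × Fin n => p.1 < p.2 ∧ w p.2 < w p.1)).card

/-- `sGen n i` is the adjacent transposition `s_i = (i, i+1)` (1-based) in `S_n`;
it is the identity for out-of-range `i`. -/
def sGen (n i : ℕ) : Equiv.Perm (Fin n) :=
  if h : 1 ≤ i ∧ i < n then Equiv.swap ⟨i - 1, by omega⟩ ⟨i, h.2⟩ else 1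

/-- `pimg d i` is the (1-based) image `(i)d` of the point `i ∈ {1,…,n}` under the
*right* action of the permutation `d` (permutations act on points on the right,
so that `(a)(στ) = ((a)σ)τ` for the group multiplication `σ * τ`);
the junk value `0` is returned for out-of-range `i`. -/
def pimg {n : ℕ} (d : Equiv.Perm (Fin n)) (i : ℕ) : ℕ :=
  if h : i - 1 < n then ((d⁻¹ ⟨i - 1, h⟩ : Fin n) : ℕ) + 1 else 0

open scoped Classical in
/-- `Hset n f` is the set `H_f(n)` of all `d ∈ S_n` such that
`(1)d < (3)d < ⋯ < (2f-1)d`, `(2i-1)d < (2i)d` for `i = 1,…,f`, and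
`(2f+1)d < (2f+2)d < ⋯ < (n)d`. -/
noncomputable def Hset (n f : ℕ) : Finset (Equiv.Perm (Fin n)) :=
  Finset.univ.filter (fun d =>
    (∀ i ∈ Finset.Icc 1 (f - 1), pimg d (2 * i - 1) < pimg d (2 * i + 1)) ∧
    (∀ i ∈ Finset.Icc 1 f, pimg d (2 * i - 1) < pimg d (2 * i)) ∧
    (∀ j ∈ Finset.Icc (2 * f + 1) (n - 1), pimg d j < pimg d (j + 1)))

/-- The index of the block of the composition `μ` containing the (0-based) point `k`. -/
def blockOf (μ : List ℕ) (k : ℕ) : ℕ :=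
  ((List.range μ.length).filter (fun j => (μ.take (j + 1)).sum ≤ k)).length

open scoped Classical in
/-- The Young subgroup `S_μ` of `S_n` associated with a composition `μ` of `n`,
as the set of permutations preserving each of the consecutive blocks of `μ`. -/
noncomputable def youngSet (n : ℕ) (μ : List ℕ) : Finset (Equiv.Perm (Fin n)) :=
  Finset.univ.filter (fun w => ∀ a : Fin n, blockOf μ ((w a : ℕ)) = blockOf μ (a : ℕ))

open scoped Classical in
/-- The set `D_μ` of minimal-length right coset representatives of `S_μ` in `S_n`:
the elements of minimal length in their right coset `S_μ d`. -/
noncomputable def Dset (n : ℕ) (μ : List ℕ) : Finset (Equiv.Perm (Fin n)) :=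
  Finset.univ.filter (fun d => ∀ u ∈ youngSet n μ, len d ≤ len (u * d))

/-- The identification of `Fin m` with the block `[k, k+m)` of `Fin n` (0-based). -/
def shiftEquiv (n k m : ℕ) (h : k + m ≤ n) :
    Fin m ≃ {a : Fin n // k ≤ (a : ℕ) ∧ (a : ℕ) < k + m} where
  toFun b := ⟨⟨k + (b : ℕ), by have := b.isLt; omega⟩, by
    constructor
    · exact Nat.le_add_right _ _
    · have := b.isLt; simp only [Fin.val_mk]; omega⟩
  invFun a := ⟨(a : Fin n) - k, by have := a.2; omega⟩
  left_inv b := by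
    apply Fin.ext
    simp
  right_inv a := by
    apply Subtype.ext
    apply Fin.ext
    have := a.2
    simp only []
    omega

open scoped Classical in
/-- The embedding of `S_m` into `S_n` as the group of permutations of the
(1-based) block `{k+1, …, k+m}` of `{1, …, n}`. -/
noncomputable def shiftEmb (n k m : ℕ) (w : Equiv.Perm (Fin m)) : Equiv.Perm (Fin n) :=
  if h : k + m ≤ n then w.extendDomain (shiftEquiv n k m h) else 1

open scoped Classical in
/-- The subgroup of `S_n` of permutations fixing the (1-based) points `1, …, k`. -/
noncomputable def fixSet (n k : ℕ) : Finset (Equiv.Perm (Fin n)) :=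
  Finset.univ.filter (fun w => ∀ a : Fin n, (a : ℕ) < k → w a = a)


/-- `bbs n i` is the permutation `𝕤_i = s_{2i} s_{2i-1} s_{2i+1} s_{2i} = (2i-1, 2i+1)(2i, 2i+2)`. -/
def bbs (n i : ℕ) : Equiv.Perm (Fin n) :=
  sGen n (2 * i) * sGen n (2 * i - 1) * sGen n (2 * i + 1) * sGen n (2 * i)

open scoped Classical in
/-- The set `𝔻_{(1,f-1)} = {𝕤_1 𝕤_2 ⋯ 𝕤_k : k = 0, …, f-1}` in `S_{2f}`. -/
noncomputable def bbD1 (f : ℕ) : Finset (Equiv.Perm (Fin (2 * f))) :=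
  (Finset.range f).image (fun k => ((List.range k).map (fun j => bbs (2 * f) (j + 1))).prod)

open scoped Classical in
/-- The set `𝔻_{(1,f-2)}^{{2,…,f}} = {𝕤_2 𝕤_3 ⋯ 𝕤_k : k = 1, …, f-1}` in `S_{2f}`. -/
noncomputable def bbD1' (f : ℕ) : Finset (Equiv.Perm (Fin (2 * f))) :=
  (Finset.Icc 1 (f - 1)).image
    (fun k => ((List.range (k - 1)).map (fun j => bbs (2 * f) (j + 2))).prod)

open scoped Classical in
/-- `H_f^{(a)} = {d ∈ H_f(n) : (1)d⁻¹ = 1, (2)d⁻¹ = 2}`. -/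
noncomputable def HsetA (n f : ℕ) : Finset (Equiv.Perm (Fin n)) :=
  (Hset n f).filter (fun d => pimg d⁻¹ 1 = 1 ∧ pimg d⁻¹ 2 = 2)

open scoped Classical in
/-- `H_f^{(b)} = {d ∈ H_f(n) : (1)d⁻¹ = 1, (2)d⁻¹ = 3}`. -/
noncomputable def HsetB (n f : ℕ) : Finset (Equiv.Perm (Fin n)) :=
  (Hset n f).filter (fun d => pimg d⁻¹ 1 = 1 ∧ pimg d⁻¹ 2 = 3)

open scoped Classical in
/-- `H_f^{(c)} = {d ∈ H_f(n) : (1)d⁻¹ = 1, (2)d⁻¹ = 2f+1}`. -/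
noncomputable def HsetC (n f : ℕ) : Finset (Equiv.Perm (Fin n)) :=
  (Hset n f).filter (fun d => pimg d⁻¹ 1 = 1 ∧ pimg d⁻¹ 2 = 2 * f + 1)

open scoped Classical in
/-- `H_f^{(d)} = {d ∈ H_f(n) : (1)d⁻¹ = 2f+1, (2)d⁻¹ = 1}`. -/
noncomputable def HsetD (n f : ℕ) : Finset (Equiv.Perm (Fin n)) :=
  (Hset n f).filter (fun d => pimg d⁻¹ 1 = 2 * f + 1 ∧ pimg d⁻¹ 2 = 1)

open scoped Classical in
/-- `H_f^{(e)} = {d ∈ H_f(n) : (1)d⁻¹ = 2f+1, (2)d⁻¹ = 2f+2}`. -/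
noncomputable def HsetE (n f : ℕ) : Finset (Equiv.Perm (Fin n)) :=
  (Hset n f).filter (fun d => pimg d⁻¹ 1 = 2 * f + 1 ∧ pimg d⁻¹ 2 = 2 * f + 2)

section Algebra

variable {F : Type*} [Field F] {A : Type*} [Ring A] [Algebra F A]

/-- For a set `S` of permutations, `hat c Tw S = Σ_{w ∈ S} c^{ℓ(w)} T_w`. -/
noncomputable def hat {n : ℕ} (c : F) (Tw : Equiv.Perm (Fin n) → A)
    (S : Finset (Equiv.Perm (Fin n))) : A :=
  ∑ w ∈ S, c ^ len w • Tw w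

/-- `Ehat E f = E_1 E_3 ⋯ E_{2f-1}`. -/
def Ehat (E : ℕ → A) (f : ℕ) : A := ((List.range f).map (fun i => E (2 * i + 1))).prod

/-- `Tprod T a b = T_a T_{a+1} ⋯ T_b` (the empty product `1` if `b < a`). -/
def Tprod (T : ℕ → A) (a b : ℕ) : A := ((List.range (b + 1 - a)).map (fun t => T (a + t))).prod

/-- `sDesc n a b = s_a s_{a-1} ⋯ s_b` (descending product of adjacent transpositions). -/
def sDesc (n a b : ℕ) : Equiv.Perm (Fin n) :=
  ((List.range (a + 1 - b)).map (fun j => sGen n (a - j))).prod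

/-- The data of a Birman–Murakami–Wenzl algebra structure: an `F`-algebra `A`
with invertible elements `T_1, …, T_{n-1}` and elements `E_1, …, E_{n-1}`
satisfying the BMW relations, together with a map `w ↦ T_w` from `S_n` to `A`
with `T_id = 1`, `T_{s_i} = T_i` and `T_{uv} = T_u T_v` whenever lengths add. -/
structure BMWData (F : Type*) [Field F] (A : Type*) [Ring A] [Algebra F A]
    (n : ℕ) (q r : F) where
  T : ℕ → A
  Tinv : ℕ → A
  E : ℕ → A
  Tw : Equiv.Perm (Fin n) → A
  hq : q ≠ 0
  hr : r ≠ 0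
  hqq : q - q⁻¹ ≠ 0
  T_mul_Tinv : ∀ i, 1 ≤ i → i ≤ n - 1 → T i * Tinv i = 1
  Tinv_mul_T : ∀ i, 1 ≤ i → i ≤ n - 1 → Tinv i * T i = 1
  skein : ∀ i, 1 ≤ i → i ≤ n - 1 → T i - Tinv i = (q - q⁻¹) • (1 - E i)
  Esq : ∀ i, 1 ≤ i → i ≤ n - 1 → E i * E i = (1 + (r - r⁻¹) / (q - q⁻¹)) • E i
  braid : ∀ i, 1 ≤ i → i + 1 ≤ n - 1 → T i * T (i + 1) * T i = T (i + 1) * T i * T (i + 1)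
  T_comm : ∀ i j, 1 ≤ i → i ≤ n - 1 → 1 ≤ j → j ≤ n - 1 → (i + 1 < j ∨ j + 1 < i) →
    T i * T j = T j * T i
  EEE₁ : ∀ i, 1 ≤ i → i + 1 ≤ n - 1 → E i * E (i + 1) * E i = E i
  EEE₂ : ∀ i, 1 ≤ i → i + 1 ≤ n - 1 → E (i + 1) * E i * E (i + 1) = E (i + 1)
  TTE₁ : ∀ i, 1 ≤ i → i + 1 ≤ n - 1 → T i * T (i + 1) * E i = E (i + 1) * E i
  TTE₂ : ∀ i, 1 ≤ i → i + 1 ≤ n - 1 → T (i + 1) * T i * E (i + 1) = E i * E (i + 1)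
  ET : ∀ i, 1 ≤ i → i ≤ n - 1 → E i * T i = r⁻¹ • E i
  TE : ∀ i, 1 ≤ i → i ≤ n - 1 → T i * E i = r⁻¹ • E i
  ETE₁ : ∀ i, 1 ≤ i → i + 1 ≤ n - 1 → E i * T (i + 1) * E i = r • E i
  ETE₂ : ∀ i, 1 ≤ i → i + 1 ≤ n - 1 → E (i + 1) * T i * E (i + 1) = r • E (i + 1)
  Tw_one : Tw 1 = 1
  Tw_s : ∀ i, 1 ≤ i → i ≤ n - 1 → Tw (sGen n i) = T i
  Tw_mul : ∀ u v : Equiv.Perm (Fin n), len (u * v) = len u + len v →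
    Tw (u * v) = Tw u * Tw v

/-- The scalars `a_f` defined by `a_0 = 1` and `a_i = a_{i-1} · Σ_{k=0}^{i-1} q^{2k}`. -/
noncomputable def aseq (q : F) : ℕ → F
  | 0 => 1
  | (i + 1) => aseq q i * (∑ k ∈ Finset.range (i + 1), q ^ (2 * k))


/-- The scalars `c_f` defined by `c_0 = 1` and
`c_f = -((q^{4f-3} - q^{2f-3})/(r q^{2n-2f-2} - q⁻¹)) · c_{f-1}`. -/
noncomputable def cseq (q r : F) (n : ℕ) : ℕ → F
  | 0 => 1
  | (f + 1) =>
      -((q ^ (4 * ((f : ℤ) + 1) - 3) - q ^ (2 * ((f : ℤ) + 1) - 3)) /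
          (r * q ^ (2 * (n : ℤ) - 2 * ((f : ℤ) + 1) - 2) - q⁻¹)) * cseq q r n f

/-- The scalars `č_f` defined by `č_0 = 1` and
`č_f = (q^{3-4f}(1 - q^{2f})/(q + r q^{2+2f-2n})) · č_{f-1}` (with integer exponents). -/
noncomputable def ccseq (q r : F) (n : ℕ) : ℕ → F
  | 0 => 1
  | (f + 1) =>
      (q ^ ((3 : ℤ) - 4 * ((f : ℤ) + 1)) * (1 - q ^ (2 * (f + 1))) /
          (q + r * q ^ ((2 : ℤ) + 2 * ((f : ℤ) + 1) - 2 * (n : ℤ)))) * ccseq q r n f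

/-- The element `x_f = (H_f⁻¹)^ · Ŝ_{{2f+1,…,n}} · Ê_f · Ĥ_f` of the BMW algebra. -/
noncomputable def xEl {F : Type*} [Field F] {A : Type*} [Ring A] [Algebra F A]
    {n : ℕ} {q r : F} (D : BMWData F A n q r) (f : ℕ) : A :=
  hat q D.Tw ((Hset n f).image (fun d => d⁻¹)) * hat q D.Tw (fixSet n (2 * f)) *
    Ehat D.E f * hat q D.Tw (Hset n f)

/-- The element `x̌_f = (H_f⁻¹)ˇ · Š_{{2f+1,…,n}} · Ê_f · Ȟ_f` of the BMW algebra,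
where `ˇ` is formed with `-q⁻¹` in place of `q`. -/
noncomputable def xElCheck {F : Type*} [Field F] {A : Type*} [Ring A] [Algebra F A]
    {n : ℕ} {q r : F} (D : BMWData F A n q r) (f : ℕ) : A :=
  hat (-q⁻¹) D.Tw ((Hset n f).image (fun d => d⁻¹)) * hat (-q⁻¹) D.Tw (fixSet n (2 * f)) *
    Ehat D.E f * hat (-q⁻¹) D.Tw (Hset n f)

end Algebra

section RelationTheory

variable {F : Type*} [Field F] {A : Type*} [Ring A] [Algebra F A]

/-- The Birman–Murakami–Wenzl relations for `T_i`, `E_i` with `1 ≤ i < N`, in a form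
that is symmetric under passing to the opposite algebra. -/
structure BMWRel (N : ℕ) (q r : F) (T E : ℕ → A) : Prop where
  hq : q ≠ 0
  hr : r ≠ 0
  sq : ∀ i, 1 ≤ i → i < N → T i * T i = 1 + (q - q⁻¹) • (T i - r⁻¹ • E i)
  ET : ∀ i, 1 ≤ i → i < N → E i * T i = r⁻¹ • E i
  TE : ∀ i, 1 ≤ i → i < N → T i * E i = r⁻¹ • E i
  TT_comm : ∀ i j, 1 ≤ i → i < N → 1 ≤ j → j < N → (i + 1 < j ∨ j + 1 < i) →
    Commute (T i) (T j)
  TE_comm : ∀ i j, 1 ≤ i → i < N → 1 ≤ j → j < N → (i + 1 < j ∨ j + 1 < i) →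
    Commute (T i) (E j)
  EE_comm : ∀ i j, 1 ≤ i → i < N → 1 ≤ j → j < N → (i + 1 < j ∨ j + 1 < i) →
    Commute (E i) (E j)
  braid : ∀ i, 1 ≤ i → i + 1 < N → T i * T (i + 1) * T i = T (i + 1) * T i * T (i + 1)
  EEE₁ : ∀ i, 1 ≤ i → i + 1 < N → E i * E (i + 1) * E i = E i
  EEE₂ : ∀ i, 1 ≤ i → i + 1 < N → E (i + 1) * E i * E (i + 1) = E (i + 1)
  TTE₁ : ∀ i, 1 ≤ i → i + 1 < N → T i * T (i + 1) * E i = E (i + 1) * E i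
  TTE₂ : ∀ i, 1 ≤ i → i + 1 < N → T (i + 1) * T i * E (i + 1) = E i * E (i + 1)
  ETT₁ : ∀ i, 1 ≤ i → i + 1 < N → E (i + 1) * T i * T (i + 1) = E (i + 1) * E i
  ETT₂ : ∀ i, 1 ≤ i → i + 1 < N → E i * T (i + 1) * T i = E i * E (i + 1)
  ETE₁ : ∀ i, 1 ≤ i → i + 1 < N → E i * T (i + 1) * E i = r • E i
  ETE₂ : ∀ i, 1 ≤ i → i + 1 < N → E (i + 1) * T i * E (i + 1) = r • E (i + 1)

/-- Membership in the left ideal `A E_i`. -/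
def Arc (E : ℕ → A) (i : ℕ) (v : A) : Prop := ∃ a, v = a * E i

namespace Arc

variable {E : ℕ → A} {i : ℕ} {v w : A}

theorem zero : Arc E i (0 : A) := ⟨0, by simp⟩

theorem add (hv : Arc E i v) (hw : Arc E i w) : Arc E i (v + w) := by
  obtain ⟨a, rfl⟩ := hv
  obtain ⟨b, rfl⟩ := hw
  exact ⟨a + b, by rw [add_mul]⟩

theorem smul (c : F) (hv : Arc E i v) : Arc E i (c • v) := by
  obtain ⟨a, rfl⟩ := hv
  exact ⟨c • a, by rw [smul_mul_assoc]⟩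

theorem mul_right {x : A} (hv : Arc E i v) (hx : Commute (E i) x) : Arc E i (v * x) := by
  obtain ⟨a, rfl⟩ := hv
  exact ⟨a * x, by rw [mul_assoc, mul_assoc, hx.eq]⟩

end Arc

namespace BMWRel

variable {N : ℕ} {q r : F} {T E : ℕ → A} {i : ℕ} {v : A}

/-- The property `v (T_k - q) ∈ A E_k` and `v (T_{j+1} - q) = v (T_j - q) E_{j+1}` for
`j ≥ k`, which replaces invariance under the `T_j` with `j ≥ k`. -/
def Quasi (N : ℕ) (q : F) (T E : ℕ → A) (k : ℕ) (v : A) : Prop :=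
  (k < N → Arc E k (v * (T k - q • 1))) ∧
    ∀ j, k ≤ j → j + 1 < N → v * (T (j + 1) - q • 1) = v * (T j - q • 1) * E (j + 1)

section Local

variable (h : BMWRel N q r T E)
include h

theorem arc_T (hi : 1 ≤ i) (hN : i < N) (hv : Arc E i v) : v * T i = r⁻¹ • v := by
  obtain ⟨a, rfl⟩ := hv
  rw [mul_assoc, h.ET i hi hN, mul_smul_comm]

theorem arc_TT_up (hi : 1 ≤ i) (hN : i + 1 < N) (hv : Arc E i v) :
    v * T (i + 1) * T i = v * E (i + 1) := by
  obtain ⟨a, rfl⟩ := hv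
  rw [mul_assoc, mul_assoc, ← mul_assoc (E i), h.ETT₂ i hi hN, mul_assoc]

theorem arc_TT_down (hi : 1 ≤ i) (hN : i + 1 < N) (hv : Arc E (i + 1) v) :
    v * T i * T (i + 1) = v * E i := by
  obtain ⟨a, rfl⟩ := hv
  rw [mul_assoc, mul_assoc, ← mul_assoc (E (i + 1)), h.ETT₁ i hi hN, mul_assoc]

theorem arc_TE_up (hi : 1 ≤ i) (hN : i + 1 < N) (hv : Arc E i v) :
    v * T (i + 1) * E i = r • v := by
  obtain ⟨a, rfl⟩ := hv
  rw [mul_assoc, mul_assoc, ← mul_assoc (E i), h.ETE₁ i hi hN, mul_smul_comm]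

theorem arc_TE_down (hi : 1 ≤ i) (hN : i + 1 < N) (hv : Arc E (i + 1) v) :
    v * T i * E (i + 1) = r • v := by
  obtain ⟨a, rfl⟩ := hv
  rw [mul_assoc, mul_assoc, ← mul_assoc (E (i + 1)), h.ETE₂ i hi hN, mul_smul_comm]

theorem arc_EE_down (hi : 1 ≤ i) (hN : i + 1 < N) (hv : Arc E (i + 1) v) :
    v * E i * E (i + 1) = v := by
  obtain ⟨a, rfl⟩ := hv
  rw [mul_assoc, mul_assoc, ← mul_assoc (E (i + 1)), h.EEE₂ i hi hN]

theorem mul_sq (hi : 1 ≤ i) (hN : i < N) (x : A) :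
    x * T i * T i = x + (q - q⁻¹) • (x * T i) - ((q - q⁻¹) * r⁻¹) • (x * E i) := by
  rw [mul_assoc, h.sq i hi hN, mul_add, mul_one, mul_smul_comm, mul_sub, mul_smul_comm]
  module

theorem mul_one_add_sub (hi : 1 ≤ i) (hN : i < N) (x : A) :
    x * (1 + q • T i) * (T i - q • 1) = -((q ^ 2 - 1) * r⁻¹) • (x * E i) := by
  have hq := h.hq
  have e := h.mul_sq hi hN x
  simp only [mul_add, add_mul, mul_sub, smul_mul_assoc, mul_smul_comm, mul_one, e]
  match_scalars <;> field_simp <;> ring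

theorem sub_mul_one_add (hi : 1 ≤ i) (hN : i < N) (x : A) :
    x * (T i - q • 1) * (1 + q • T i) = -((q ^ 2 - 1) * r⁻¹) • (x * E i) := by
  have hq := h.hq
  have e := h.mul_sq hi hN x
  simp only [mul_add, sub_mul, mul_sub, smul_mul_assoc, mul_smul_comm, mul_one, e]
  match_scalars <;> field_simp <;> ring

theorem arc_sq_up (hi : 1 ≤ i) (hN : i + 1 < N) (hv : Arc E i v) :
    (q : F) • (v * T (i + 1) * T i * T i * (1 + q • T (i + 1))) + v * T (i + 1) * T i =
      q ^ 2 • (v * T (i + 1) * T i) + v * (1 + q • T (i + 1)) := by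
  have hq := h.hq
  have hr := h.hr
  have e1 := h.mul_sq hi (by omega) (v * T (i + 1))
  have e2 := h.arc_TE_up hi hN hv
  have e3 := h.arc_TT_up hi hN hv
  have e4 : v * E (i + 1) * T (i + 1) = r⁻¹ • (v * E (i + 1)) := by
    rw [mul_assoc, h.ET _ (by omega) hN, mul_smul_comm]
  have e5 := h.mul_sq (by omega) hN v
  rw [e1, e2]
  simp only [mul_add, add_mul, sub_mul, smul_mul_assoc, mul_smul_comm, mul_one, e3, e4, e5]
  match_scalars <;> field_simp <;> ring

theorem arc_lower_up (hi : 1 ≤ i) (hN : i + 1 < N) (hv : Arc E i v) :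
    (v * T (i + 1) + q • (v * T (i + 1) * T i)) * (T i - q • 1) = -(q ^ 2 - 1) • v := by
  have e := h.mul_one_add_sub hi (by omega) (v * T (i + 1))
  rw [h.arc_TE_up hi hN hv, mul_add, mul_one, mul_smul_comm] at e
  rw [e, smul_smul]
  have hr := h.hr
  congr 1
  field_simp

theorem arc_arc_lower (hi : 1 ≤ i) (hN : i + 2 < N) (hv : Arc E i v) (hv' : Arc E (i + 2) v) :
    v * T (i + 1) * (T i - q • 1) * (1 + q • T (i + 2)) = -(q ^ 2 - 1) • v := by
  have e : v * T (i + 1) * (T i - q • 1) = v * T (i + 1) * (T (i + 2) - q • 1) := by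
    rw [mul_sub, mul_sub, h.arc_TT_up hi (by omega) hv, h.arc_TT_down (by omega) hN hv']
  have hr := h.hr
  rw [e, h.sub_mul_one_add (by omega) hN, h.arc_TE_down (by omega) hN hv', smul_smul]
  congr 1
  field_simp

theorem arc_arc_pass (hi : 1 ≤ i) (hN : i + 2 < N) (hv : Arc E i v) (hv' : Arc E (i + 2) v) :
    v * T (i + 1) * T i * (1 + q • T (i + 2) + q ^ 2 • (T (i + 2) * T (i + 1))) =
      v * (1 + q • T (i + 1) + q ^ 2 • (T (i + 1) * T (i + 2))) := by
  have hq := h.hq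
  have hr := h.hr
  have e1 : v * T (i + 1) * T i = v * T (i + 1) * T (i + 2) := by
    rw [h.arc_TT_up hi (by omega) hv, h.arc_TT_down (by omega) hN hv']
  have e2 := h.mul_sq (by omega) hN (v * T (i + 1))
  have e3 := h.arc_TE_down (by omega) hN hv'
  have e4 := h.arc_TT_down (by omega) hN hv'
  have e6 : v * E (i + 1) * T (i + 1) = r⁻¹ • (v * E (i + 1)) := by
    rw [mul_assoc, h.ET _ (by omega) (by omega), mul_smul_comm]
  have e7 := h.mul_sq (i := i + 1) (by omega) (by omega) v
  rw [e1]
  simp only [mul_add, mul_smul_comm, mul_one, ← mul_assoc, e2, e3]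
  rw [e4]
  simp only [add_mul, sub_mul, smul_mul_assoc, e6, e7]
  match_scalars <;> field_simp <;> ring

theorem arc_arc_absorb (hi : 1 ≤ i) (hN : i + 2 < N) (hv : Arc E i v) (hv' : Arc E (i + 2) v) :
    v * T (i + 1) * T i * T (i + 2) * T (i + 1) = v := by
  rw [h.arc_TT_up hi (by omega) hv, mul_assoc, mul_assoc, ← mul_assoc (E (i + 1)),
    h.ETT₂ (i + 1) (by omega) hN, ← mul_assoc, h.arc_EE_down (by omega) hN hv']

theorem lower_triple (hi : 1 ≤ i) (hN : i + 1 < N)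
    (hv : Arc E (i + 1) (v * (T (i + 1) - q • 1))) :
    v * (1 + q • T i + q ^ 2 • (T i * T (i + 1))) * (T (i + 1) - q • 1) =
      v * (1 + q • T i + q ^ 2 • (T i * T (i + 1))) * (T i - q • 1) * E (i + 1) := by
  have hq := h.hq
  have hr := h.hr
  have e1 := h.arc_TE_down hi hN hv
  have e2 := h.mul_sq hi (by omega) v
  have e3 := h.mul_sq (by omega) hN (v * T i)
  have e4 : v * T i * T (i + 1) * T i * E (i + 1) = r⁻¹ • (v * E i * E (i + 1)) := by
    rw [mul_assoc _ (T (i + 1)), mul_assoc _ (T (i + 1) * T i), h.TTE₂ i hi hN,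
      mul_assoc, ← mul_assoc (T i), h.TE i hi (by omega), smul_mul_assoc, mul_smul_comm,
      mul_assoc]
  have e5 : v * T i * T (i + 1) * E (i + 1) = r⁻¹ • (v * T i * E (i + 1)) := by
    rw [mul_assoc _ (T (i + 1)), h.TE _ (by omega) hN, mul_smul_comm]
  have e6 : v * T (i + 1) * T i * E (i + 1) = v * E i * E (i + 1) := by
    rw [mul_assoc, mul_assoc, ← mul_assoc (T (i + 1)), h.TTE₂ i hi hN, mul_assoc]
  simp only [mul_sub, sub_mul, smul_mul_assoc, mul_smul_comm, mul_one, e6, smul_sub] at e1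
  simp only [mul_add, add_mul, mul_sub, sub_mul, smul_mul_assoc, mul_smul_comm, mul_one,
    ← mul_assoc, e2, e3, e4, e5]
  have hv1 : v * T (i + 1) =
      q • v + r⁻¹ • (v * E i * E (i + 1) - q • (v * T i * E (i + 1))) := by
    rw [e1, smul_sub, smul_smul, smul_smul, inv_mul_cancel₀ hr]
    module
  rw [hv1]
  match_scalars <;> field_simp <;> ring

end Local

end BMWRel

section Recursions

variable (q : F) (T : ℕ → A)

/-- The descending product `T_{s+k} ⋯ T_{s+1}`. -/
def desc (s : ℕ) : ℕ → A
  | 0 => 1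
  | k + 1 => T (s + k + 1) * desc s k

/-- The sum over the minimal coset representatives of `S_1 × S_{m-1}` in the symmetric group
on the points `s+1, …, s+m`. -/
def row : ℕ → ℕ → A
  | 0, _ => 0
  | m + 1, s => 1 + q • (T (s + 1) * row m (s + 1))

/-- The sum over the minimal coset representatives of `S_2 × S_{m-2}` in the symmetric group
on the points `s+1, …, s+m`. -/
def pairs : ℕ → ℕ → A
  | 0, _ => 0
  | m + 1, s => q ^ 2 • (T (s + 2) * (T (s + 1) * pairs m (s + 1))) + row q T m (s + 1)

/-- The sum over the minimal coset representatives of `S_3 × S_{m-3}` in the symmetric group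
on the points `s+1, …, s+m`. -/
def triples : ℕ → ℕ → A
  | 0, _ => 0
  | m + 1, s => q ^ 3 • (T (s + 3) * (T (s + 2) * (T (s + 1) * triples m (s + 1)))) +
      pairs q T m (s + 1)

/-- The sum over the representatives `H_f` for the symmetric group on `s+1, …, s+m`. -/
def matchings : ℕ → ℕ → ℕ → A
  | 0, _, _ => 1
  | _ + 1, 0, _ => 0
  | _ + 1, 1, _ => 0
  | f + 1, m + 2, s => q ^ (2 * (f + 1)) • (desc T s (2 * (f + 1)) * matchings (f + 1) (m + 1) (s + 1)) +
      matchings f m (s + 2) * row q T (m + 1) (s + 1)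

/-- The sum over the representatives in `H_f` which fix the first point and whose restriction
to the points other than the first pair is minimal. -/
def matchingsPrev : ℕ → ℕ → ℕ → A
  | f + 1, m + 2, s => matchings q T f m (s + 2)
  | _, _, _ => 0

/-- The auxiliary sum obtained from `matchings` by raising the length of the second factors. -/
def matchingsAux (f : ℕ) : ℕ → ℕ → A
  | 0, _ => 0
  | m + 1, s => q ^ (2 * f) • (desc T s (2 * f) * matchings q T f m (s + 1) * row q T (m + 1) s) +
      matchingsPrev q T f (m + 1) s * pairs q T (m + 1) s

/-- The sum over the symmetric group on the points `s+1, …, s+m`. -/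
def symSum : ℕ → ℕ → A
  | 0, _ => 1
  | m + 1, s => symSum m (s + 1) * row q T (m + 1) s

theorem matchings_succ (f m s : ℕ) : matchings q T f (m + 1) s =
    q ^ (2 * f) • (desc T s (2 * f) * matchings q T f m (s + 1)) +
      matchingsPrev q T f (m + 1) s * row q T m (s + 1) := by
  rcases f with _ | f
  · simp [matchings, matchingsPrev, desc]
  · rcases m with _ | m
    · simp [matchings, matchingsPrev]
    · simp [matchings, matchingsPrev]

@[simp] theorem matchings_zero (m s : ℕ) : matchings q T 0 m s = 1 := by
  simp [matchings]

theorem matchings_eq_zero {f m : ℕ} (hm : m < 2 * f) (s : ℕ) : matchings q T f m s = 0 := by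
  induction m using Nat.strong_induction_on generalizing f s with
  | _ m ih =>
    rcases f with _ | f
    · omega
    rcases m with _ | _ | m
    · simp [matchings]
    · simp [matchings]
    · rw [matchings, ih (m + 1) (by omega) (by omega), ih m (by omega) (by omega)]
      simp

theorem matchings_one (m s : ℕ) : matchings q T 1 m s = pairs q T m s := by
  induction m generalizing s with
  | zero => simp [matchings, pairs]
  | succ m ih =>
    rw [matchings_succ, pairs, ih]
    rcases m with _ | m
    · simp [pairs, matchingsPrev, row]
    · simp [matchingsPrev, desc, mul_assoc]

theorem desc_add_two (s k : ℕ) : desc T s (k + 2) = desc T (s + 2) k * T (s + 2) * T (s + 1) := by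
  induction k with
  | zero => simp [desc]
  | succ k ih =>
    rw [desc, ih, desc, show s + (k + 2) + 1 = s + 2 + k + 1 by ring]
    simp only [mul_assoc]

variable {q T}

theorem commute_desc {s k : ℕ} {x : A} (hx : ∀ j, s < j → j ≤ s + k → Commute x (T j)) :
    Commute x (desc T s k) := by
  induction k with
  | zero => simp [desc]
  | succ k ih =>
    exact (hx _ (by omega) (by omega)).mul_right (ih fun j h1 h2 => hx j h1 (by omega))

theorem commute_row {s m : ℕ} {x : A} (hx : ∀ j, s < j → j < s + m → Commute x (T j)) :
    Commute x (row q T m s) := by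
  induction m generalizing s with
  | zero => simp [row]
  | succ m ih =>
    rcases m with _ | m
    · simp [row]
    · exact (Commute.one_right _).add_right (((hx _ (by omega) (by omega)).mul_right
        (ih fun j h1 h2 => hx j (by omega) (by omega))).smul_right q)

theorem commute_pairs {s m : ℕ} {x : A} (hx : ∀ j, s < j → j < s + m → Commute x (T j)) :
    Commute x (pairs q T m s) := by
  induction m generalizing s with
  | zero => simp [pairs]
  | succ m ih =>
    rcases m with _ | _ | m
    · simp [pairs, row]
    · simp [pairs, row]
    · exact (((hx _ (by omega) (by omega)).mul_right ((hx _ (by omega) (by omega)).mul_right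
        (ih fun j h1 h2 => hx j (by omega) (by omega)))).smul_right _).add_right
        (commute_row fun j h1 h2 => hx j (by omega) (by omega))

theorem commute_matchings {f s m : ℕ} {x : A} (hx : ∀ j, s < j → j < s + m → Commute x (T j)) :
    Commute x (matchings q T f m s) := by
  induction m using Nat.strong_induction_on generalizing f s with
  | _ m ih =>
    by_cases hm : m < 2 * f
    · simp [matchings_eq_zero q T hm]
    rcases f with _ | f
    · simp
    rcases m with _ | _ | m
    · omega
    · omega
    rw [matchings]
    refine Commute.add_right (Commute.smul_right ?_ _) (Commute.mul_right ?_ ?_)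
    · by_cases hm' : m + 1 < 2 * (f + 1)
      · simp [matchings_eq_zero q T hm']
      · exact (commute_desc fun j h1 h2 => hx j h1 (by omega)).mul_right
          (ih (m + 1) (by omega) fun j h1 h2 => hx j (by omega) (by omega))
    · exact ih m (by omega) fun j h1 h2 => hx j (by omega) (by omega)
    · exact commute_row fun j h1 h2 => hx j (by omega) (by omega)

theorem commute_symSum {s m : ℕ} {x : A} (hx : ∀ j, s < j → j < s + m → Commute x (T j)) :
    Commute x (symSum q T m s) := by
  induction m generalizing s with
  | zero => simp [symSum]
  | succ m ih =>
    exact (ih fun j h1 h2 => hx j (by omega) (by omega)).mul_right (commute_row hx)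

end Recursions

namespace BMWRel

variable {N : ℕ} {q r : F} {T E : ℕ → A} {i : ℕ} {v : A}

section Factorizations

variable (h : BMWRel N q r T E)
include h

theorem row_mul_row {m s : ℕ} (hs : s + m + 1 ≤ N) :
    row q T m (s + 1) * row q T (m + 1) s = (1 + q • T (s + 1)) * pairs q T (m + 1) s := by
  induction m generalizing s with
  | zero => simp [row, pairs]
  | succ m ih =>
    rcases m with _ | m
    · simp [row, pairs]
    set a := T (s + 1) with ha
    set b := T (s + 2) with hb
    have hR : row q T (m + 2) (s + 1) = 1 + q • (b * row q T (m + 1) (s + 2)) := rfl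
    have hc : row q T (m + 1) (s + 2) * a = a * row q T (m + 1) (s + 2) :=
      (commute_row fun j h1 h2 => h.TT_comm _ _ (by omega) (by omega) (by omega) (by omega)
        (by omega)).eq.symm
    have ih' : row q T (m + 1) (s + 2) * row q T (m + 2) (s + 1) =
        (1 + q • b) * pairs q T (m + 2) (s + 1) := ih (by omega)
    have hbr : ∀ x, a * (b * (a * x)) = b * (a * (b * x)) := fun x => by
      simpa only [mul_assoc] using congrArg (· * x) (h.braid (s + 1) (by omega) (by omega))
    have e : row q T (m + 2) (s + 1) * a * row q T (m + 2) (s + 1) =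
        a * row q T (m + 2) (s + 1) +
          q • (b * (a * ((1 + q • b) * pairs q T (m + 2) (s + 1)))) := by
      rw [← ih']
      conv_lhs => rw [hR, add_mul, one_mul, smul_mul_assoc, mul_assoc b, hc, ← hR]
      simp only [add_mul, smul_mul_assoc, mul_assoc]
    have hR' : row q T (m + 3) s = 1 + q • (a * row q T (m + 2) (s + 1)) := rfl
    rw [hR', pairs, mul_add, mul_one, mul_smul_comm, ← mul_assoc, e]
    simp only [add_mul, mul_add, smul_mul_assoc, mul_smul_comm, one_mul, smul_smul, smul_add, hbr,
      ← ha, ← hb]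
    module

theorem row_mul_pairs {m s : ℕ} (hs : s + m + 2 ≤ N) :
    row q T m (s + 2) * pairs q T (m + 2) s =
      (1 + q • T (s + 2) + q ^ 2 • (T (s + 2) * T (s + 1))) * triples q T (m + 2) s := by
  induction m generalizing s with
  | zero => simp [row, pairs, triples]
  | succ m ih =>
    rcases m with _ | m
    · simp only [row, pairs, triples, mul_zero, smul_zero, zero_add, add_zero, mul_one, one_mul,
        show s + 1 + 1 = s + 2 from rfl]
      module
    set a := T (s + 1) with ha
    set b := T (s + 2) with hb
    set c := T (s + 3) with hc
    have hR : row q T (m + 2) (s + 2) = 1 + q • (c * row q T (m + 1) (s + 3)) := rfl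
    have hca : ∀ x, row q T (m + 1) (s + 3) * (a * x) = a * (row q T (m + 1) (s + 3) * x) := by
      intro x
      rw [← mul_assoc, ← mul_assoc, (commute_row fun j h1 h2 => h.TT_comm (s + 1) j (by omega)
        (by omega) (by omega) (by omega) (by omega)).eq]
    have hcb : ∀ x, row q T (m + 1) (s + 3) * (b * x) = b * (row q T (m + 1) (s + 3) * x) := by
      intro x
      rw [← mul_assoc, ← mul_assoc, (commute_row fun j h1 h2 => h.TT_comm (s + 2) j (by omega)
        (by omega) (by omega) (by omega) (by omega)).eq]
    have ih' : row q T (m + 1) (s + 3) * pairs q T (m + 3) (s + 1) =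
        (1 + q • c + q ^ 2 • (c * b)) * triples q T (m + 3) (s + 1) := ih (by omega)
    have hab : ∀ x, a * (b * (a * x)) = b * (a * (b * x)) := fun x => by
      simpa only [mul_assoc] using congrArg (· * x) (h.braid (s + 1) (by omega) (by omega))
    have hbc : ∀ x, b * (c * (b * x)) = c * (b * (c * x)) := fun x => by
      simpa only [mul_assoc] using congrArg (· * x) (h.braid (s + 2) (by omega) (by omega))
    have hac : ∀ x, a * (c * x) = c * (a * x) := fun x => by
      rw [← mul_assoc, ← mul_assoc, (h.TT_comm (s + 1) (s + 3) (by omega) (by omega) (by omega)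
        (by omega) (by omega)).eq]
    have k1 : ∀ x, b * (c * (b * (a * x))) = c * (b * (a * (c * x))) := fun x => by
      rw [hbc, hac]
    have k2 : ∀ x, b * (a * (c * (b * (a * x)))) = c * (b * (a * (c * (b * x)))) := fun x => by
      rw [hac, hab, hbc, hac]
    have e : row q T (m + 2) (s + 2) * (b * (a * pairs q T (m + 3) (s + 1))) =
        b * (a * pairs q T (m + 3) (s + 1)) + q • (c * (b * (a * ((1 + q • c + q ^ 2 • (c * b)) *
          triples q T (m + 3) (s + 1))))) := by
      rw [← ih', ← hca, ← hcb, hR]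
      simp only [add_mul, one_mul, smul_mul_assoc, mul_assoc]
    have e2 : row q T (m + 2) (s + 2) * row q T (m + 3) (s + 1) =
      (1 + q • b) * pairs q T (m + 3) (s + 1) := h.row_mul_row (by omega)
    rw [pairs, triples, mul_add, mul_smul_comm, ← ha, ← hb, e, e2]
    simp only [add_mul, mul_add, smul_mul_assoc, mul_smul_comm, one_mul, smul_smul, smul_add,
      mul_assoc, ← hc, k1, k2]
    module

theorem pairs_mul_row {m s : ℕ} (hs : s + m + 2 ≤ N) :
    pairs q T (m + 1) (s + 1) * row q T (m + 2) s =
      (1 + q • T (s + 1) + q ^ 2 • (T (s + 1) * T (s + 2))) * triples q T (m + 2) s := by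
  induction m generalizing s with
  | zero => simp [row, pairs, triples]
  | succ m ih =>
    set a := T (s + 1) with ha
    set b := T (s + 2) with hb
    set c := T (s + 3) with hc
    have ca : ∀ j, s + 2 < j → j < N → Commute a (T j) := fun j h1 h2 =>
      h.TT_comm (s + 1) j (by omega) (by omega) (by omega) (by omega) (by omega)
    have hP : pairs q T (m + 2) (s + 1) =
        q ^ 2 • (c * (b * pairs q T (m + 1) (s + 2))) + row q T (m + 1) (s + 2) := rfl
    have hca : pairs q T (m + 1) (s + 2) * a = a * pairs q T (m + 1) (s + 2) :=
      (commute_pairs fun j h1 h2 => ca j h1 (by omega)).eq.symm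
    have hcb : row q T (m + 1) (s + 2) * a = a * row q T (m + 1) (s + 2) :=
      (commute_row fun j h1 h2 => ca j h1 (by omega)).eq.symm
    have ih' : pairs q T (m + 1) (s + 2) * row q T (m + 2) (s + 1) =
        (1 + q • b + q ^ 2 • (b * c)) * triples q T (m + 2) (s + 1) := ih (by omega)
    have hab : ∀ x, a * (b * (a * x)) = b * (a * (b * x)) := fun x => by
      simpa only [mul_assoc] using congrArg (· * x) (h.braid (s + 1) (by omega) (by omega))
    have e2 : row q T (m + 1) (s + 2) * row q T (m + 2) (s + 1) =
      (1 + q • b) * pairs q T (m + 2) (s + 1) := h.row_mul_row (by omega)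
    have e : pairs q T (m + 2) (s + 1) * (a * row q T (m + 2) (s + 1)) =
        q ^ 2 • (c * (b * (a * ((1 + q • b + q ^ 2 • (b * c)) * triples q T (m + 2) (s + 1))))) +
          a * ((1 + q • b) * pairs q T (m + 2) (s + 1)) := by
      rw [← ih', ← e2]
      conv_lhs => rw [hP, add_mul, smul_mul_assoc, mul_assoc, mul_assoc, ← mul_assoc _ a, hca,
        ← mul_assoc _ a, hcb]
      simp only [mul_assoc]
    rw [row, triples, mul_add, mul_smul_comm, mul_one, ← ha, e]
    rcases m with _ | m
    · simp only [triples, pairs, row, mul_zero, smul_zero, mul_add, mul_smul_comm, add_zero, mul_one,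
        ← hb, ← hc]
      module
    have hbc : ∀ x, b * (c * (b * x)) = c * (b * (c * x)) := fun x => by
      simpa only [mul_assoc] using congrArg (· * x) (h.braid (s + 2) (by omega) (by omega))
    have hac : ∀ x, a * (c * x) = c * (a * x) := fun x => by
      rw [← mul_assoc, ← mul_assoc, (ca (s + 3) (by omega) (by omega)).eq]
    simp only [add_mul, mul_add, smul_mul_assoc, mul_smul_comm, one_mul, smul_smul, smul_add,
      mul_assoc, ← hb, ← hc]
    have k1 : ∀ x, a * (c * (b * (a * x))) = c * (b * (a * (b * x))) := fun x => by
      rw [hac, hab]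
    have k2 : ∀ x, a * (b * (c * (b * (a * x)))) = c * (b * (a * (b * (c * x)))) := fun x => by
      rw [hbc, ← hac x, hac, hab]
    simp only [k1, k2]
    module

theorem symSum_add_two {m s : ℕ} (hs : s + m + 2 ≤ N) :
    symSum q T (m + 2) s =
      (1 + q • T (s + 1)) * (symSum q T m (s + 2) * pairs q T (m + 2) s) := by
  have hc : Commute (1 + q • T (s + 1)) (symSum q T m (s + 2)) :=
    (Commute.one_left _).add_left ((commute_symSum fun j h1 h2 => h.TT_comm _ _ (by omega)
      (by omega) (by omega) (by omega) (by omega)).smul_left q)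
  rw [symSum, symSum, mul_assoc, h.row_mul_row (by omega), ← mul_assoc, ← hc.eq, mul_assoc]

end Factorizations

section Descending

variable (h : BMWRel N q r T E)
include h

theorem E_mul_desc {s k K : ℕ} (hs : s < k) (hk : k + 1 ≤ s + K) (hN : s + K < N) :
    E k * desc T s K = desc T s K * E (k + 1) := by
  induction K with
  | zero => omega
  | succ K ih =>
    rcases Nat.lt_or_ge (k + 1) (s + K + 1) with hlt | hge
    · rw [desc, ← mul_assoc, ← (h.TE_comm (s + K + 1) k (by omega) (by omega) (by omega) (by omega)
        (by omega)).eq, mul_assoc, ih (by omega) (by omega), mul_assoc]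
    · obtain ⟨K, rfl⟩ : ∃ K', K = K' + 1 := ⟨K - 1, by omega⟩
      obtain rfl : k = s + K + 1 := by omega
      have hc : Commute (E (s + K + 1 + 1)) (desc T s K) :=
        commute_desc fun j h1 h2 => (h.TE_comm j _ (by omega) (by omega) (by omega) (by omega)
          (by omega)).symm
      rw [desc, desc, show s + (K + 1) + 1 = s + K + 1 + 1 by ring, mul_assoc, mul_assoc, ← hc.eq,
        ← mul_assoc, ← mul_assoc, h.ETT₂ _ (by omega) (by omega), ← mul_assoc, ← mul_assoc,
        h.TTE₂ _ (by omega) (by omega)]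

theorem desc_mul_desc_mul_T {s k : ℕ} (hN : s + k + 1 < N) :
    desc T s k * desc T (s + 1) k * T (s + 1) =
      T (s + k + 1) * (desc T s k * desc T (s + 1) k) := by
  induction k with
  | zero => simp [desc]
  | succ k ih =>
    have hc : Commute (T (s + k + 2)) (desc T s k) :=
      commute_desc fun j h1 h2 => h.TT_comm _ j (by omega) (by omega) (by omega) (by omega)
        (by omega)
    have e : desc T s (k + 1) * desc T (s + 1) (k + 1) =
        T (s + k + 1) * (T (s + k + 2) * (desc T s k * desc T (s + 1) k)) := by
      rw [desc, desc, show s + 1 + k + 1 = s + k + 2 by ring, mul_assoc, ← mul_assoc (desc T s k),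
        ← hc.eq, mul_assoc]
    rw [e, mul_assoc, mul_assoc, ih (by omega), ← mul_assoc, ← mul_assoc,
      h.braid (s + k + 1) (by omega) (by omega), show s + (k + 1) + 1 = s + k + 2 by ring]
    simp only [mul_assoc]

end Descending

/-- The property `v ∈ A E_{s+2t+1}` for all `t < f`. -/
def Arcs (E : ℕ → A) (s f : ℕ) (v : A) : Prop := ∀ t < f, Arc E (s + 2 * t + 1) v

theorem Arcs.mul_right_of_commute {s f : ℕ} {x : A} (hv : Arcs E s f v)
    (hx : ∀ t < f, Commute (E (s + 2 * t + 1)) x) : Arcs E s f (v * x) :=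
  fun t ht => (hv t ht).mul_right (hx t ht)

theorem Arcs.tail {s f : ℕ} (hv : Arcs E s (f + 1) v) : Arcs E (s + 2) f v := fun t ht => by
  rw [show s + 2 + 2 * t + 1 = s + 2 * (t + 1) + 1 by ring]
  exact hv (t + 1) (by omega)

section Arcs

variable (h : BMWRel N q r T E)
include h

theorem arcs_mul_desc {s f : ℕ} (hN : s + 2 * f < N) (hv : Arcs E s f v) :
    Arcs E (s + 1) f (v * desc T s (2 * f)) := by
  intro t ht
  obtain ⟨a, ha⟩ := hv t ht
  refine ⟨a * desc T s (2 * f), ?_⟩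
  rw [ha, mul_assoc, h.E_mul_desc (by omega) (by omega) hN, mul_assoc,
    show s + 1 + 2 * t + 1 = s + 2 * t + 1 + 1 by ring]

theorem mul_desc_mul_desc {s f : ℕ} (hN : s + 2 * f + 1 < N) (hv : Arcs E s (f + 1) v) :
    v * desc T s (2 * f) * desc T (s + 1) (2 * f) = v := by
  induction f with
  | zero => simp [desc]
  | succ f ih =>
    have hc : ∀ i, s + 2 * f + 1 < i → i < N → Commute (T i) (desc T s (2 * f)) := fun i h1 h2 =>
      commute_desc fun j h3 h4 => h.TT_comm _ j (by omega) (by omega) (by omega) (by omega)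
        (by omega)
    have e1 : desc T s (2 * (f + 1)) =
        T (s + 2 * f + 2) * (T (s + 2 * f + 1) * desc T s (2 * f)) := rfl
    have e2 : desc T (s + 1) (2 * (f + 1)) =
        T (s + 2 * f + 3) * (T (s + 2 * f + 2) * desc T (s + 1) (2 * f)) := by
      rw [show s + 2 * f + 3 = s + 1 + (2 * f + 1) + 1 by ring,
        show s + 2 * f + 2 = s + 1 + 2 * f + 1 by ring]
      rfl
    have e3 := h.arc_arc_absorb (i := s + 2 * f + 1) (by omega) (by omega) (hv f (by omega))
      (hv (f + 1) (by omega))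
    have e4 := ih (by omega) fun t ht => hv t (by omega)
    calc v * desc T s (2 * (f + 1)) * desc T (s + 1) (2 * (f + 1))
        = v * T (s + 2 * f + 2) * T (s + 2 * f + 1) *
            ((desc T s (2 * f) * T (s + 2 * f + 3)) * T (s + 2 * f + 2)) *
              desc T (s + 1) (2 * f) := by
          rw [e1, e2]; simp only [mul_assoc]
      _ = v * T (s + 2 * f + 2) * T (s + 2 * f + 1) * T (s + 2 * f + 3) * T (s + 2 * f + 2) *
            desc T s (2 * f) * desc T (s + 1) (2 * f) := by
          rw [← (hc (s + 2 * f + 3) (by omega) (by omega)).eq, mul_assoc (T (s + 2 * f + 3)),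
            ← (hc (s + 2 * f + 2) (by omega) (by omega)).eq]
          simp only [mul_assoc]
      _ = v := by rw [e3, e4]

theorem arc_arc_row_pairs {s m : ℕ} (hs : s + m + 4 ≤ N) (hv : Arc E (s + 1) v)
    (hv' : Arc E (s + 3) v) :
    v * T (s + 2) * T (s + 1) * (row q T (m + 1) (s + 3) * pairs q T (m + 3) (s + 1)) =
      v * (pairs q T (m + 2) (s + 2) * row q T (m + 3) (s + 1)) := by
  have e1 := h.row_mul_pairs (m := m + 1) (s := s + 1) (by omega)
  have e2 := h.pairs_mul_row (m := m + 1) (s := s + 1) (by omega)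
  have e3 := h.arc_arc_pass (i := s + 1) (by omega) (by omega) hv hv'
  simp only [show s + 1 + 1 = s + 2 from rfl, show s + 1 + 2 = s + 3 from rfl,
    show m + 1 + 1 = m + 2 from rfl, show m + 1 + 2 = m + 3 from rfl] at e1 e2 e3
  rw [e1, e2, ← mul_assoc, e3, mul_assoc]

theorem T_comm_matchings {f s m i : ℕ} (hi : 1 ≤ i) (his : i ≤ s) (hs : s + 1 + m ≤ N) :
    Commute (T i) (matchings q T f m (s + 1)) :=
  commute_matchings fun j h1 h2 => h.TT_comm _ j (by omega) (by omega) (by omega) (by omega)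
    (by omega)

theorem E_comm_matchings {f s m i : ℕ} (hi : 1 ≤ i) (his : i ≤ s) (hs : s + 1 + m ≤ N) :
    Commute (E i) (matchings q T f m (s + 1)) :=
  commute_matchings fun j h1 h2 => (h.TE_comm j i (by omega) (by omega) (by omega) (by omega)
    (by omega)).symm

theorem T_comm_row {s m i : ℕ} (hi : 1 ≤ i) (his : i ≤ s) (hs : s + 1 + m ≤ N) :
    Commute (T i) (row q T m (s + 1)) :=
  commute_row fun j h1 h2 => h.TT_comm _ j (by omega) (by omega) (by omega) (by omega)
    (by omega)

theorem E_comm_row {s m i : ℕ} (hi : 1 ≤ i) (his : i ≤ s) (hs : s + 1 + m ≤ N) :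
    Commute (E i) (row q T m (s + 1)) :=
  commute_row fun j h1 h2 => (h.TE_comm j i (by omega) (by omega) (by omega) (by omega)
    (by omega)).symm

theorem matchings_mul_pairs {f m s : ℕ} (hs : s + m + 2 ≤ N) (hv : Arcs E s (f + 1) v) :
    v * matchings q T f m (s + 2) * pairs q T (m + 2) s =
      (∑ t ∈ range (f + 1), q ^ (2 * t)) • (v * matchings q T (f + 1) (m + 2) s) := by
  induction m using Nat.strong_induction_on generalizing f s v with
  | _ m ih =>
    rcases f with _ | f
    · simp [matchings_one]
    rcases m with _ | _ | m
    · rw [matchings_eq_zero q T (by omega), matchings_eq_zero q T (by omega)]; simp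
    · rw [matchings_eq_zero q T (by omega), matchings_eq_zero q T (by omega)]; simp
    have hA : v * (desc T (s + 2) (2 * (f + 1)) * matchings q T (f + 1) (m + 1) (s + 3)) *
          (T (s + 2) * (T (s + 1) * pairs q T (m + 3) (s + 1))) =
        (∑ t ∈ range (f + 2), q ^ (2 * t)) •
          (v * (desc T s (2 * (f + 2)) * matchings q T (f + 2) (m + 3) (s + 1))) := by
      by_cases hm : m + 1 < 2 * (f + 1)
      · rw [matchings_eq_zero q T hm, matchings_eq_zero q T (by omega)]; simp
      · have e := ih (m + 1) (by omega) (f := f + 1) (s := s + 1) (by omega)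
          (h.arcs_mul_desc (by omega) hv)
        have c1 := (h.T_comm_matchings (f := f + 1) (s := s + 2) (m := m + 1) (i := s + 1)
          (by omega) (by omega) (by omega)).eq
        have c2 := (h.T_comm_matchings (f := f + 1) (s := s + 2) (m := m + 1) (i := s + 2)
          (by omega) (by omega) (by omega)).eq
        calc _ = v * (desc T (s + 2) (2 * (f + 1)) * T (s + 2) * T (s + 1)) *
              matchings q T (f + 1) (m + 1) (s + 3) * pairs q T (m + 3) (s + 1) := by
              simp only [mul_assoc] at c1 c2 ⊢
              rw [← mul_assoc (matchings q T (f + 1) (m + 1) (s + 3)), ← c2, mul_assoc,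
                ← mul_assoc (matchings q T (f + 1) (m + 1) (s + 3)), ← c1, mul_assoc]
          _ = _ := by
              rw [← desc_add_two]
              refine e.trans ?_
              rw [mul_assoc]
    have hB : v * (matchings q T f m (s + 4) * row q T (m + 1) (s + 3)) *
          (T (s + 2) * (T (s + 1) * pairs q T (m + 3) (s + 1))) =
        (∑ t ∈ range (f + 1), q ^ (2 * t)) •
          (v * matchings q T (f + 1) (m + 2) (s + 2) * row q T (m + 3) (s + 1)) := by
      have c1 := (h.T_comm_row (s := s + 2) (m := m + 1) (i := s + 1)
          (by omega) (by omega) (by omega)).eq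
      have c2 := (h.T_comm_row (s := s + 2) (m := m + 1) (i := s + 2)
          (by omega) (by omega) (by omega)).eq
      have hw : ∀ i, 1 ≤ i → i ≤ s + 3 → Arc E i v → Arc E i (v * matchings q T f m (s + 4)) :=
        fun i h1 h2 h3 => h3.mul_right (h.E_comm_matchings h1 h2 (by omega))
      have e1 := h.arc_arc_row_pairs (m := m) (s := s) (by omega)
        (hw _ (by omega) (by omega) (hv 0 (by omega)))
        (hw _ (by omega) (by omega) (hv 1 (by omega)))
      have e2 := ih m (by omega) (f := f) (s := s + 2) (by omega) (v := v)
        hv.tail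
      rw [← smul_mul_assoc, ← e2, mul_assoc _ (pairs _ _ _ _), ← e1]
      simp only [mul_assoc]
      rw [← mul_assoc (row _ _ _ _), ← c2, mul_assoc, ← mul_assoc (row _ _ _ _), ← c1, mul_assoc]
    have hH : matchings q T (f + 1) (m + 2) (s + 2) = q ^ (2 * (f + 1)) •
        (desc T (s + 2) (2 * (f + 1)) * matchings q T (f + 1) (m + 1) (s + 3)) +
        matchings q T f m (s + 4) * row q T (m + 1) (s + 3) := by rw [matchings]
    have hH' : matchings q T (f + 2) (m + 4) s = q ^ (2 * (f + 2)) •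
        (desc T s (2 * (f + 2)) * matchings q T (f + 2) (m + 3) (s + 1)) +
        matchings q T (f + 1) (m + 2) (s + 2) * row q T (m + 3) (s + 1) := by rw [matchings]
    have hP : pairs q T (m + 4) s = q ^ 2 • (T (s + 2) * (T (s + 1) * pairs q T (m + 3) (s + 1)))
      + row q T (m + 3) (s + 1) := rfl
    have hsum : ∑ t ∈ range (f + 2), q ^ (2 * t) = 1 + q ^ 2 * ∑ t ∈ range (f + 1), q ^ (2 * t) := by
      rw [sum_range_succ', mul_sum, add_comm]
      exact congrArg₂ _ (by simp) (sum_congr rfl fun t _ => by ring)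
    rw [hP, mul_add, mul_smul_comm]
    conv_lhs => enter [1]; rw [hH, mul_add v, add_mul, mul_smul_comm, smul_mul_assoc, hA, hB]
    rw [hH', hsum, mul_add v, mul_smul_comm, mul_assoc]
    module

end Arcs

/-- The condition on `v` under which `v · matchings f` can be analysed: `v` is divisible by
`E_{s+1}, E_{s+3}, …, E_{s+2f-1}` and quasi-invariant under the remaining generators. -/
structure Good (N : ℕ) (q : F) (T E : ℕ → A) (s f : ℕ) (v : A) : Prop where
  arcs : Arcs E s f v
  quasi : Quasi N q T E (s + 2 * f + 1) v

theorem Quasi.add {k : ℕ} {w : A} (hv : Quasi N q T E k v) (hw : Quasi N q T E k w) :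
    Quasi N q T E k (v + w) := by
  refine ⟨fun hk => ?_, fun j h1 h2 => ?_⟩
  · rw [add_mul]; exact (hv.1 hk).add (hw.1 hk)
  · rw [add_mul, add_mul, add_mul, hv.2 j h1 h2, hw.2 j h1 h2]

theorem Quasi.smul {k : ℕ} (c : F) (hv : Quasi N q T E k v) : Quasi N q T E k (c • v) := by
  refine ⟨fun hk => ?_, fun j h1 h2 => ?_⟩
  · rw [smul_mul_assoc]; exact (hv.1 hk).smul c
  · rw [smul_mul_assoc, smul_mul_assoc, smul_mul_assoc, hv.2 j h1 h2]

theorem Quasi.zero {k : ℕ} : Quasi N q T E k (0 : A) :=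
  ⟨fun _ => by rw [zero_mul]; exact Arc.zero, fun j _ _ => by simp⟩

theorem Quasi.of_le {k : ℕ} (hk : N ≤ k) : Quasi N q T E k v :=
  ⟨fun h => by omega, fun j _ _ => by omega⟩

theorem Quasi.succ {k : ℕ} (hv : Quasi N q T E k v) : Quasi N q T E (k + 1) v :=
  ⟨fun hk => ⟨_, hv.2 k le_rfl hk⟩, fun j h1 h2 => hv.2 j (by omega) h2⟩

theorem Quasi.mul_right {k : ℕ} {x : A} (hv : Quasi N q T E k v)
    (hT : ∀ j, k ≤ j → j < N → Commute (T j) x) (hE : ∀ j, k ≤ j → j < N → Commute (E j) x) :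
    Quasi N q T E k (v * x) := by
  have hc : ∀ j, k ≤ j → j < N → v * x * (T j - q • 1) = v * (T j - q • 1) * x := fun j h1 h2 => by
    rw [mul_sub, mul_sub, sub_mul, mul_assoc, ← (hT j h1 h2).eq]
    simp only [mul_assoc, mul_smul_comm, mul_one, smul_mul_assoc]
  refine ⟨fun hk => ?_, fun j h1 h2 => ?_⟩
  · rw [hc k le_rfl hk]
    exact (hv.1 hk).mul_right (hE k le_rfl hk)
  · rw [hc _ (by omega) h2, hc _ h1 (by omega), hv.2 j h1 h2, mul_assoc,
      (hE _ (by omega) h2).eq, mul_assoc, mul_assoc, mul_assoc]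

section Good

variable (h : BMWRel N q r T E)
include h

omit h in
theorem Good.tail {s f : ℕ} (hv : Good N q T E s (f + 1) v) : Good N q T E (s + 2) f v :=
  ⟨hv.arcs.tail, by
    rw [show s + 2 + 2 * f + 1 = s + 2 * (f + 1) + 1 by ring]; exact hv.quasi⟩

theorem good_mul_desc {s f : ℕ} (hN : s + 2 * f < N) (hv : Good N q T E s f v) :
    Good N q T E (s + 1) f (v * desc T s (2 * f)) := by
  refine ⟨h.arcs_mul_desc hN hv.arcs, ?_⟩
  rw [show s + 1 + 2 * f + 1 = s + 2 * f + 1 + 1 by ring]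
  refine hv.quasi.succ.mul_right (fun j h1 h2 => ?_) (fun j h1 h2 => ?_)
  · exact commute_desc fun i h3 h4 => h.TT_comm _ _ (by omega) (by omega) (by omega) (by omega)
      (by omega)
  · exact commute_desc fun i h3 h4 => (h.TE_comm _ _ (by omega) (by omega) (by omega) (by omega)
      (by omega)).symm

theorem good_mul_sub {s f : ℕ} (hN : s + 2 * f + 1 < N) (hv : Good N q T E s f v) :
    Good N q T E s (f + 1) (v * (T (s + 2 * f + 1) - q • 1)) := by
  refine ⟨fun t ht => ?_, ?_⟩
  · rcases Nat.lt_or_ge t f with h1 | h1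
    · exact (hv.arcs t h1).mul_right (((h.TE_comm _ _ (by omega) (by omega) (by omega) (by omega)
        (by omega)).symm).sub_right ((Commute.one_right _).smul_right q))
    · obtain rfl : t = f := by omega
      exact hv.quasi.1 hN
  · rw [show s + 2 * (f + 1) + 1 = s + 2 * f + 1 + 1 + 1 by ring]
    refine hv.quasi.succ.succ.mul_right (fun j h1 h2 => ?_) (fun j h1 h2 => ?_)
    · exact (h.TT_comm _ _ (by omega) (by omega) (by omega) (by omega)
        (by omega)).sub_right ((Commute.one_right _).smul_right q)
    · exact (h.TE_comm _ _ (by omega) (by omega) (by omega) (by omega)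
        (by omega)).symm.sub_right ((Commute.one_right _).smul_right q)

theorem good_mul_desc_mul_sub {s f : ℕ} (hN : s + 2 * f + 2 < N) (hv : Good N q T E s f v) :
    v * desc T s (2 * f) * (T (s + 2 * f + 2) - q • 1) =
      v * (T (s + 2 * f + 1) - q • 1) * desc T s (2 * (f + 1)) := by
  have hc : Commute (T (s + 2 * f + 2) - q • 1) (desc T s (2 * f)) :=
    (commute_desc fun i h3 h4 => h.TT_comm _ _ (by omega) (by omega) (by omega) (by omega)
      (by omega)).sub_left ((Commute.one_left _).smul_left q)
  have e := hv.quasi.2 (s + 2 * f + 1) le_rfl hN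
  rw [← h.arc_TT_up (by omega) hN (hv.quasi.1 (by omega))] at e
  rw [mul_assoc, ← hc.eq, ← mul_assoc, e, show 2 * (f + 1) = 2 * f + 1 + 1 by ring, desc, desc,
    show s + (2 * f + 1) + 1 = s + 2 * f + 1 + 1 by ring]
  simp only [mul_assoc]

theorem good_mul_desc_mul_desc {s f : ℕ} (hN : s + 2 * f + 1 < N) (hv : Good N q T E s f v) :
    v * desc T s (2 * f) * desc T (s + 1) (2 * f) * T (s + 1) =
      q • (v * desc T s (2 * f) * desc T (s + 1) (2 * f)) + v * (T (s + 2 * f + 1) - q • 1) := by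
  have e1 := h.desc_mul_desc_mul_T (s := s) (k := 2 * f) hN
  have e2 := h.mul_desc_mul_desc hN (h.good_mul_sub hN hv).arcs
  conv_rhs => rw [← e2]
  rw [mul_assoc v, mul_assoc v, e1]
  simp only [mul_sub, sub_mul, mul_smul_comm, smul_mul_assoc, mul_one, mul_assoc]
  module

/-- The part of the recursion for `matchingsAux` in which the first two points are matched. -/
theorem good_mul_prev {s g m : ℕ} (hN : s + m + 3 = N) (hv : Arcs E s (g + 1) v) :
    q ^ (2 * g + 3) • (v * desc T s (2 * (g + 1)) * matchings q T g m (s + 3) *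
        row q T (m + 1) (s + 2) * T (s + 1) * row q T (m + 2) (s + 1)) +
      q ^ 2 • (v * matchings q T g (m + 1) (s + 2) * T (s + 2) * T (s + 1) *
        pairs q T (m + 2) (s + 1)) =
    q ^ (2 * g + 4) • (v * desc T s (2 * (g + 1)) * matchings q T g m (s + 3) *
        pairs q T (m + 2) (s + 1)) +
      q ^ 2 • (v * matchingsAux q T g (m + 1) (s + 2) * row q T (m + 2) (s + 1)) := by
  have hA : q • (v * desc T s (2 * (g + 1)) * matchings q T g m (s + 3) *
        row q T (m + 1) (s + 2) * T (s + 1) * row q T (m + 2) (s + 1)) +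
      v * desc T (s + 2) (2 * g) * matchings q T g m (s + 3) * T (s + 2) * T (s + 1) *
        pairs q T (m + 2) (s + 1) =
      q ^ 2 • (v * desc T s (2 * (g + 1)) * matchings q T g m (s + 3) *
        pairs q T (m + 2) (s + 1)) +
      v * desc T (s + 2) (2 * g) * matchings q T g m (s + 3) * row q T (m + 1) (s + 2) *
        row q T (m + 2) (s + 1) := by
    by_cases hm : m < 2 * g
    · simp [matchings_eq_zero q T hm]
    have c1 := (h.T_comm_matchings (f := g) (s := s + 2) (m := m) (i := s + 1)
      (by omega) (by omega) (by omega)).eq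
    have c2 := (h.T_comm_matchings (f := g) (s := s + 2) (m := m) (i := s + 2)
      (by omega) (by omega) (by omega)).eq
    have c3 := (h.T_comm_row (s := s + 1) (m := m + 1) (i := s + 1)
      (by omega) (by omega) (by omega)).eq
    have e1 : row q T (m + 1) (s + 2) * row q T (m + 2) (s + 1) =
      (1 + q • T (s + 2)) * pairs q T (m + 2) (s + 1) := h.row_mul_row (by omega)
    have hp : Arc E (s + 1) (v * desc T (s + 2) (2 * g) * matchings q T g m (s + 3)) :=
      ((hv 0 (by omega)).mul_right (commute_desc fun j h1 h2 => (h.TE_comm _ _ (by omega)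
        (by omega) (by omega) (by omega) (by omega)).symm)).mul_right
        (h.E_comm_matchings (by omega) (by omega) (by omega))
    have e2 := h.arc_sq_up (by omega) (by omega) hp
    have e3 : v * desc T s (2 * (g + 1)) * matchings q T g m (s + 3) =
        v * desc T (s + 2) (2 * g) * matchings q T g m (s + 3) * T (s + 2) * T (s + 1) := by
      rw [show 2 * (g + 1) = 2 * g + 2 by ring, desc_add_two]
      simp only [mul_assoc] at c1 c2 ⊢
      rw [c1, ← mul_assoc (T (s + 2)), c2, mul_assoc]
    rw [e3, mul_assoc _ _ (T (s + 1)), ← c3, ← mul_assoc, mul_assoc _ _ (row q T (m + 2) (s + 1)),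
      e1, mul_assoc _ _ (row q T (m + 2) (s + 1)), e1, ← mul_assoc, ← mul_assoc,
      ← smul_mul_assoc, ← add_mul, e2, add_mul, smul_mul_assoc]
  have hB : v * matchingsPrev q T g (m + 1) (s + 2) * row q T m (s + 3) * T (s + 2) * T (s + 1) *
        pairs q T (m + 2) (s + 1) =
      v * matchingsPrev q T g (m + 1) (s + 2) * pairs q T (m + 1) (s + 2) *
        row q T (m + 2) (s + 1) := by
    rcases g with _ | g
    · simp [matchingsPrev]
    rcases m with _ | m
    · simp [matchingsPrev]
    have c1 := (h.T_comm_row (s := s + 2) (m := m + 1) (i := s + 1)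
      (by omega) (by omega) (by omega)).eq
    have c2 := (h.T_comm_row (s := s + 2) (m := m + 1) (i := s + 2)
      (by omega) (by omega) (by omega)).eq
    have hw : ∀ i, 1 ≤ i → i ≤ s + 3 → Arc E i v → Arc E i (v * matchings q T g m (s + 4)) :=
      fun i h1 h2 h3 => h3.mul_right (h.E_comm_matchings h1 h2 (by omega))
    have e := h.arc_arc_row_pairs (m := m) (s := s) (by omega)
      (hw _ (by omega) (by omega) (hv 0 (by omega)))
      (hw _ (by omega) (by omega) (hv 1 (by omega)))
    simp only [matchingsPrev]
    rw [mul_assoc _ (pairs _ _ _ _), ← e, mul_assoc _ _ (T (s + 2)), ← c2, ← mul_assoc,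
      mul_assoc _ _ (T (s + 1)), ← c1, ← mul_assoc, mul_assoc]
  have hH := matchings_succ q T g m (s + 2)
  have hK : matchingsAux q T g (m + 1) (s + 2) = q ^ (2 * g) • (desc T (s + 2) (2 * g) *
      matchings q T g m (s + 3) * row q T (m + 1) (s + 2)) +
      matchingsPrev q T g (m + 1) (s + 2) * pairs q T (m + 1) (s + 2) := rfl
  rw [hH, hK]
  simp only [mul_add v, add_mul, mul_smul_comm, smul_mul_assoc, ← mul_assoc]
  simp only [show s + 2 + 1 = s + 3 from rfl]
  linear_combination (norm := module) q ^ (2 * g + 2) • hA + q ^ 2 • hB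

theorem good_mul_aux_succ {s f m : ℕ} (hN : s + (m + 1) = N) (hv : Good N q T E s f v) :
    v * matchingsAux q T f (m + 1) s = v * matchings q T f (m + 1) s +
      q ^ (2 * f + 2) • (v * desc T s (2 * f) * matchingsAux q T f m (s + 1)) +
      q ^ (4 * f + 1) • (v * (T (s + 2 * f + 1) - q • 1) *
        matchingsPrev q T (f + 1) (m + 1) s * row q T m (s + 1)) +
      (match f, m with
        | g + 1, m + 1 => q ^ 2 • (v * matchingsAux q T g m (s + 2) * row q T (m + 1) (s + 1))
        | _, _ => 0) := by
  rcases f with _ | g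
  · rcases m with _ | m
    · simp [matchingsAux, matchingsPrev, row, desc]
    · simp only [matchingsAux, matchingsPrev, matchings_zero, row, desc, mul_zero, pow_zero,
        zero_add, one_smul, one_mul, mul_one, zero_mul, add_zero, mul_add, sub_mul, mul_sub,
        smul_mul_assoc, mul_smul_comm, ← mul_assoc, pow_one]
      module
  rcases m with _ | m
  · simp [matchingsAux, matchingsPrev, row, matchings]
  have hX : v * desc T s (2 * (g + 1)) * desc T (s + 1) (2 * (g + 1)) *
        matchings q T (g + 1) m (s + 2) * T (s + 1) * row q T (m + 1) (s + 1) =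
      q • (v * desc T s (2 * (g + 1)) * desc T (s + 1) (2 * (g + 1)) *
        matchings q T (g + 1) m (s + 2) * row q T (m + 1) (s + 1)) +
      v * (T (s + 2 * (g + 1) + 1) - q • 1) * matchings q T (g + 1) m (s + 2) *
        row q T (m + 1) (s + 1) := by
    by_cases hm : m < 2 * (g + 1)
    · simp [matchings_eq_zero q T hm]
    have c1 := (h.T_comm_matchings (f := g + 1) (s := s + 1) (m := m) (i := s + 1)
      (by omega) (by omega) (by omega)).eq
    have e3 := h.good_mul_desc_mul_desc (by omega) hv
    rw [mul_assoc _ _ (T (s + 1)), ← c1, ← mul_assoc, e3]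
    simp only [add_mul, smul_mul_assoc]
  have hY : q ^ (2 * g + 3) • (v * desc T s (2 * (g + 1)) *
        matchingsPrev q T (g + 1) (m + 1) (s + 1) * row q T m (s + 2) * T (s + 1) *
          row q T (m + 1) (s + 1)) +
      q ^ 2 • (v * matchings q T g m (s + 2) * T (s + 2) * T (s + 1) *
        pairs q T (m + 1) (s + 1)) =
    q ^ (2 * g + 4) • (v * desc T s (2 * (g + 1)) * matchingsPrev q T (g + 1) (m + 1) (s + 1) *
        pairs q T (m + 1) (s + 1)) +
      q ^ 2 • (v * matchingsAux q T g m (s + 2) * row q T (m + 1) (s + 1)) := by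
    rcases m with _ | m
    · simp [matchingsPrev, matchingsAux, row, pairs]
    · exact h.good_mul_prev (by omega) hv.arcs
  have hK : matchingsAux q T (g + 1) (m + 2) s = q ^ (2 * (g + 1)) • (desc T s (2 * (g + 1)) *
      matchings q T (g + 1) (m + 1) (s + 1) * row q T (m + 2) s) +
      matchings q T g m (s + 2) * pairs q T (m + 2) s := rfl
  have hK' : matchingsAux q T (g + 1) (m + 1) (s + 1) = q ^ (2 * (g + 1)) •
      (desc T (s + 1) (2 * (g + 1)) * matchings q T (g + 1) m (s + 2) * row q T (m + 1) (s + 1)) +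
      matchingsPrev q T (g + 1) (m + 1) (s + 1) * pairs q T (m + 1) (s + 1) := rfl
  have hH : matchings q T (g + 1) (m + 2) s = q ^ (2 * (g + 1)) • (desc T s (2 * (g + 1)) *
      matchings q T (g + 1) (m + 1) (s + 1)) + matchings q T g m (s + 2) * row q T (m + 1) (s + 1) :=
    matchings_succ q T (g + 1) (m + 1) s
  have hH' : matchings q T (g + 1) (m + 1) (s + 1) = q ^ (2 * (g + 1)) •
      (desc T (s + 1) (2 * (g + 1)) * matchings q T (g + 1) m (s + 2)) +
      matchingsPrev q T (g + 1) (m + 1) (s + 1) * row q T m (s + 2) :=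
    matchings_succ q T (g + 1) m (s + 1)
  have hR : row q T (m + 2) s = 1 + q • (T (s + 1) * row q T (m + 1) (s + 1)) := rfl
  have hP : pairs q T (m + 2) s = q ^ 2 • (T (s + 2) * (T (s + 1) * pairs q T (m + 1) (s + 1))) +
      row q T (m + 1) (s + 1) := rfl
  have hQ : matchingsPrev q T (g + 1 + 1) (m + 1 + 1) s = matchings q T (g + 1) m (s + 2) := rfl
  have hX' := congrArg (fun z => q ^ (4 * g + 5) • z) hX
  simp only [hQ]
  rw [hK, hK', hH, hR, hP, hH']
  generalize desc T s (2 * (g + 1)) = D at *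
  generalize desc T (s + 1) (2 * (g + 1)) = D' at *
  generalize matchings q T (g + 1) m (s + 2) = M at *
  generalize matchingsPrev q T (g + 1) (m + 1) (s + 1) = M' at *
  generalize T (s + 2 * (g + 1) + 1) - q • 1 = ξ at *
  generalize row q T (m + 1) (s + 1) = R1 at *
  simp only [mul_add v, mul_add D, mul_add (_ * _ : A), add_mul, mul_smul_comm, smul_mul_assoc,
    ← mul_assoc, mul_one, smul_add] at hX' hY ⊢
  linear_combination (norm := module) hX' + hY

omit h in
theorem matchingsAux_eq_zero {f m : ℕ} (hm : m < 2 * f) (s : ℕ) :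
    matchingsAux q T f m s = 0 := by
  rcases m with _ | m
  · rfl
  rcases f with _ | f
  · omega
  rcases m with _ | m
  · simp [matchingsAux, matchings, matchingsPrev]
  · simp only [matchingsAux, matchingsPrev]
    rw [matchings_eq_zero q T (by omega), matchings_eq_zero q T (by omega)]
    simp

theorem good_mul_aux {s f m : ℕ} (hN : s + m = N) (hv : Good N q T E s f v) :
    ((q ^ 2 - 1) * q ^ (2 * f)) • (v * matchingsAux q T f m s) =
      (q ^ (2 * m) - q ^ (2 * f)) • (v * matchings q T f m s) +
      (q ^ (4 * f + 1) * (q ^ (2 * f + 2) - 1)) •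
        (v * (T (s + 2 * f + 1) - q • 1) * matchings q T (f + 1) m s) := by
  induction m using Nat.strong_induction_on generalizing s f v with
  | _ m ih =>
    rcases m with _ | m
    · rcases f with _ | f <;> simp [matchingsAux, matchings]
    have e1 : ((q ^ 2 - 1) * q ^ (2 * f)) • (v * desc T s (2 * f) * matchingsAux q T f m (s + 1)) =
        (q ^ (2 * m) - q ^ (2 * f)) • (v * desc T s (2 * f) * matchings q T f m (s + 1)) +
        (q ^ (4 * f + 1) * (q ^ (2 * f + 2) - 1)) • (v * (T (s + 2 * f + 1) - q • 1) *
          desc T s (2 * (f + 1)) * matchings q T (f + 1) m (s + 1)) := by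
      by_cases hm : m < 2 * f
      · rw [matchingsAux_eq_zero hm, matchings_eq_zero q T hm,
          matchings_eq_zero q T (show m < 2 * (f + 1) by omega)]
        simp
      rw [ih m (by omega) (by omega) (h.good_mul_desc (by omega) hv)]
      by_cases hm' : m < 2 * (f + 1)
      · simp [matchings_eq_zero q T hm']
      rw [show s + 1 + 2 * f + 1 = s + 2 * f + 2 by ring, h.good_mul_desc_mul_sub (by omega) hv]
    have e2 := h.good_mul_aux_succ hN hv
    have e3 := matchings_succ q T f m s
    have e4 := matchings_succ q T (f + 1) m s
    rw [e2]
    rcases f with _ | g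
    · simp only [e3, e4, mul_add v, mul_add (_ * _ : A), mul_smul_comm, ← mul_assoc,
        show matchingsPrev q T 0 (m + 1) s = 0 from rfl, zero_mul, mul_zero] at e1 ⊢
      linear_combination (norm := module) q ^ 2 • e1
    rcases m with _ | m
    · simp [matchings, row, matchingsAux, matchingsPrev]
    have e5 := ih m (by omega) (f := g) (by omega) hv.tail
    have e6 := congrArg (fun z => q ^ 4 • (z * row q T (m + 1) (s + 1))) e5
    simp only [show s + 2 + 2 * g + 1 = s + 2 * (g + 1) + 1 by ring,
      add_mul, smul_mul_assoc] at e6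
    simp only [e3, e4, mul_add v, mul_add (_ * _ : A), mul_smul_comm, ← mul_assoc,
        show matchingsPrev q T (g + 1) (m + 1 + 1) s = matchings q T g m (s + 2) from rfl,
        show matchingsPrev q T (g + 1 + 1) (m + 1 + 1) s = matchings q T (g + 1) m (s + 2) from rfl]
    linear_combination (norm := module) q ^ (2 * g + 4) • e1 + e6

theorem good_lower_aux {s g m : ℕ} (hN : s + m + 2 = N) (hv : Arcs E s (g + 1) v) :
    q ^ (2 * g + 2) • (v * desc T s (2 * (g + 1)) * matchingsPrev q T (g + 1) (m + 1) (s + 1) *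
        row q T m (s + 2) * (T (s + 1) - q • 1)) +
      q • (v * matchings q T g m (s + 2) * T (s + 2) * row q T m (s + 2) * (T (s + 1) - q • 1)) =
    -(q * (q ^ 2 - 1)) • (v * matchingsAux q T g m (s + 2)) := by
  rcases m with _ | m
  · simp [row, matchingsAux]
  have cR : Commute (T (s + 1) - q • 1) (row q T (m + 1) (s + 2)) :=
    (h.T_comm_row (by omega) (by omega) (by omega)).sub_left ((Commute.one_left _).smul_left q)
  have hA : q • (v * desc T s (2 * (g + 1)) * matchings q T g m (s + 3) *
        row q T (m + 1) (s + 2) * (T (s + 1) - q • 1)) +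
      v * desc T (s + 2) (2 * g) * matchings q T g m (s + 3) * T (s + 2) *
        row q T (m + 1) (s + 2) * (T (s + 1) - q • 1) =
      -(q ^ 2 - 1) • (v * desc T (s + 2) (2 * g) * matchings q T g m (s + 3) *
        row q T (m + 1) (s + 2)) := by
    by_cases hm : m < 2 * g
    · simp [matchings_eq_zero q T hm]
    have c1 := (h.T_comm_matchings (f := g) (s := s + 2) (m := m) (i := s + 1)
      (by omega) (by omega) (by omega)).eq
    have c2 := (h.T_comm_matchings (f := g) (s := s + 2) (m := m) (i := s + 2)
      (by omega) (by omega) (by omega)).eq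
    have hp : Arc E (s + 1) (v * desc T (s + 2) (2 * g) * matchings q T g m (s + 3)) :=
      ((hv 0 (by omega)).mul_right (commute_desc fun j h1 h2 => (h.TE_comm _ _ (by omega)
        (by omega) (by omega) (by omega) (by omega)).symm)).mul_right
        (h.E_comm_matchings (by omega) (by omega) (by omega))
    have e2 := h.arc_lower_up (by omega) (by omega) hp
    have e3 : v * desc T s (2 * (g + 1)) * matchings q T g m (s + 3) =
        v * desc T (s + 2) (2 * g) * matchings q T g m (s + 3) * T (s + 2) * T (s + 1) := by
      rw [show 2 * (g + 1) = 2 * g + 2 by ring, desc_add_two]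
      simp only [mul_assoc] at c1 c2 ⊢
      rw [c1, ← mul_assoc (T (s + 2)), c2, mul_assoc]
    rw [e3, mul_assoc _ _ (T (s + 1) - q • 1), ← cR.eq, mul_assoc _ _ (T (s + 1) - q • 1), ← cR.eq,
      ← mul_assoc, ← mul_assoc]
    have e2' := congrArg (· * row q T (m + 1) (s + 2)) e2
    simp only [add_mul, smul_mul_assoc, show s + 1 + 1 = s + 2 from rfl] at e2'
    rw [add_comm]
    exact e2'
  have hB : v * matchingsPrev q T g (m + 1) (s + 2) * row q T m (s + 3) * T (s + 2) *
        row q T (m + 1) (s + 2) * (T (s + 1) - q • 1) =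
      -(q ^ 2 - 1) • (v * matchingsPrev q T g (m + 1) (s + 2) * pairs q T (m + 1) (s + 2)) := by
    rcases g with _ | g
    · simp [matchingsPrev]
    rcases m with _ | m
    · simp [matchingsPrev]
    have c1 : Commute (T (s + 1) - q • 1) (row q T (m + 1) (s + 3)) :=
      (h.T_comm_row (by omega) (by omega) (by omega)).sub_left ((Commute.one_left _).smul_left q)
    have c2 := (h.T_comm_row (s := s + 2) (m := m + 1) (i := s + 2)
      (by omega) (by omega) (by omega)).eq
    have hw : ∀ i, 1 ≤ i → i ≤ s + 3 → Arc E i v → Arc E i (v * matchings q T g m (s + 4)) :=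
      fun i h1 h2 h3 => h3.mul_right (h.E_comm_matchings h1 h2 (by omega))
    have e := h.arc_arc_lower (i := s + 1) (by omega) (by omega)
      (hw _ (by omega) (by omega) (hv 0 (by omega)))
      (hw _ (by omega) (by omega) (hv 1 (by omega)))
    have e1 : row q T (m + 1) (s + 3) * row q T (m + 2) (s + 2) =
      (1 + q • T (s + 3)) * pairs q T (m + 2) (s + 2) := h.row_mul_row (by omega)
    simp only [matchingsPrev]
    rw [mul_assoc _ _ (T (s + 1) - q • 1), ← cR.eq, ← mul_assoc, mul_assoc _ _ (T (s + 2)), ← c2,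
      ← mul_assoc, mul_assoc _ _ (T (s + 1) - q • 1), ← c1.eq, ← mul_assoc, mul_assoc _ _ (row _ _ _ _),
      e1, ← mul_assoc, e, smul_mul_assoc]
  have hH := matchings_succ q T g m (s + 2)
  have hK : matchingsAux q T g (m + 1) (s + 2) = q ^ (2 * g) • (desc T (s + 2) (2 * g) *
      matchings q T g m (s + 3) * row q T (m + 1) (s + 2)) +
      matchingsPrev q T g (m + 1) (s + 2) * pairs q T (m + 1) (s + 2) := rfl
  rw [hH, hK, show matchingsPrev q T (g + 1) (m + 1 + 1) (s + 1) = matchings q T g m (s + 3) from rfl]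
  generalize T (s + 1) - q • 1 = ξ at *
  simp only [mul_add v, add_mul, mul_smul_comm, smul_mul_assoc, ← mul_assoc]
  simp only [show s + 2 + 1 = s + 3 from rfl]
  linear_combination (norm := module) q ^ (2 * g + 1) • hA + q • hB

theorem good_lower {s f n : ℕ} (hn : 2 ≤ n) (hN : s + n = N) (hv : Good N q T E s f v) :
    q ^ (2 * f + 1) • (v * matchings q T f n s * (T (s + 1) - q • 1)) =
      (q ^ (2 * f + 1) * r⁻¹ - q ^ (2 * n)) • (v * matchingsPrev q T f n s) +
      q ^ (4 * f + 1) • (v * (T (s + 2 * f + 1) - q • 1) * matchingsPrev q T (f + 1) n s) := by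
  obtain ⟨m, rfl⟩ : ∃ m, n = m + 2 := ⟨n - 2, by omega⟩
  rcases f with _ | g
  · simp [matchingsPrev]
  have h1 : v * desc T s (2 * (g + 1)) * desc T (s + 1) (2 * (g + 1)) *
        matchings q T (g + 1) m (s + 2) * (T (s + 1) - q • 1) =
      v * (T (s + 2 * (g + 1) + 1) - q • 1) * matchings q T (g + 1) m (s + 2) := by
    by_cases hm : m < 2 * (g + 1)
    · simp [matchings_eq_zero q T hm]
    have c1 := (h.T_comm_matchings (f := g + 1) (s := s + 1) (m := m) (i := s + 1)
      (by omega) (by omega) (by omega)).eq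
    rw [mul_sub, mul_assoc _ _ (T (s + 1)), ← c1, ← mul_assoc,
      h.good_mul_desc_mul_desc (by omega) hv]
    simp only [add_mul, smul_mul_assoc, mul_smul_comm, mul_one]
    abel
  have h2 : v * matchings q T g m (s + 2) * (T (s + 1) - q • 1) =
      (r⁻¹ - q) • (v * matchings q T g m (s + 2)) := by
    rw [mul_sub, h.arc_T (by omega) (by omega) ((hv.arcs 0 (by omega)).mul_right
      (h.E_comm_matchings (by omega) (by omega) (by omega))), mul_smul_comm, mul_one]
    module
  have h3 := h.good_lower_aux (by omega) hv.arcs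
  have h4 := h.good_mul_aux (m := m) (by omega) hv.tail
  rw [show s + 2 + 2 * g + 1 = s + 2 * (g + 1) + 1 by ring] at h4
  rw [show matchingsPrev q T (g + 1) (m + 2) s = matchings q T g m (s + 2) from rfl,
    show matchingsPrev q T (g + 1 + 1) (m + 2) s = matchings q T (g + 1) m (s + 2) from rfl,
    show matchings q T (g + 1) (m + 2) s = q ^ (2 * (g + 1)) • (desc T s (2 * (g + 1)) *
      matchings q T (g + 1) (m + 1) (s + 1)) + matchings q T g m (s + 2) * row q T (m + 1) (s + 1)
      from matchings_succ q T (g + 1) (m + 1) s,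
    show matchings q T (g + 1) (m + 1) (s + 1) = q ^ (2 * (g + 1)) •
      (desc T (s + 1) (2 * (g + 1)) * matchings q T (g + 1) m (s + 2)) +
      matchingsPrev q T (g + 1) (m + 1) (s + 1) * row q T m (s + 2) from
      matchings_succ q T (g + 1) m (s + 1),
    show row q T (m + 1) (s + 1) = 1 + q • (T (s + 2) * row q T m (s + 2)) from rfl]
  generalize T (s + 1) - q • 1 = ξ at *
  generalize desc T s (2 * (g + 1)) = D at *
  simp only [mul_add v, mul_add D, mul_add (_ * _ : A), add_mul, mul_smul_comm, smul_mul_assoc,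
    ← mul_assoc, smul_add, mul_one]
  linear_combination (norm := module) q ^ (6 * g + 7) • h1 + q ^ (2 * g + 3) • h2 +
    q ^ (2 * g + 3) • h3 - q ^ 4 • h4

end Good

section Row

variable (h : BMWRel N q r T E)
include h

omit h in
theorem Quasi.of_succ {k : ℕ} (hv : Quasi N q T E (k + 1) v)
    (hA : k < N → Arc E k (v * (T k - q • 1)))
    (hP : k + 1 < N → v * (T (k + 1) - q • 1) = v * (T k - q • 1) * E (k + 1)) :
    Quasi N q T E k v := by
  refine ⟨hA, fun j h1 h2 => ?_⟩
  rcases eq_or_lt_of_le h1 with rfl | h3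
  · exact hP h2
  · exact hv.2 j h3 h2

theorem arc_mul_row {s m : ℕ} (hN : s + m = N) (hs : s + 1 < N) (hv : Quasi N q T E (s + 2) v) :
    Arc E (s + 1) (v * row q T m s * (T (s + 1) - q • 1)) := by
  obtain ⟨m, rfl⟩ : ∃ k, m = k + 2 := ⟨m - 2, by omega⟩
  have e : v * row q T (m + 2) s * (T (s + 1) - q • 1) =
      v * (1 + q • T (s + 1)) * (T (s + 1) - q • 1) +
      q ^ 2 • (v * T (s + 1) * T (s + 2) * row q T m (s + 2) * (T (s + 1) - q • 1)) := by
    simp only [row, show s + 1 + 1 = s + 2 from rfl]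
    generalize T (s + 1) - q • 1 = ξ
    simp only [mul_add v, mul_add (_ * _ : A), add_mul, mul_smul_comm, smul_mul_assoc, ← mul_assoc,
      mul_one, smul_add]
    module
  rw [e, h.mul_one_add_sub (by omega) hs]
  refine Arc.add (Arc.smul _ ⟨_, rfl⟩) (Arc.smul _ ?_)
  rcases m with _ | m
  · simpa [row] using Arc.zero
  have c1 : Commute (T (s + 1)) (row q T (m + 1) (s + 2)) :=
    h.T_comm_row (by omega) (by omega) (by omega)
  have hb := h.braid (s + 1) (by omega) (by omega)
  have e2 : v * T (s + 1) * T (s + 2) * row q T (m + 1) (s + 2) * (T (s + 1) - q • 1) =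
      v * (T (s + 2) - q • 1) * T (s + 1) * T (s + 2) * row q T (m + 1) (s + 2) := by
    have hb' := congrArg (fun x => v * x * row q T (m + 1) (s + 2)) hb
    simp only [← mul_assoc, show s + 1 + 1 = s + 2 from rfl] at hb'
    rw [mul_sub, mul_assoc _ _ (T (s + 1)), ← c1.eq]
    simp only [← mul_assoc, mul_sub, sub_mul, mul_smul_comm, smul_mul_assoc, mul_one]
    rw [hb']
  rw [e2, h.arc_TT_down (i := s + 1) (by omega) (by omega) (hv.1 (by omega)), mul_assoc,
    (h.E_comm_row (s := s + 1) (m := m + 1) (i := s + 1) (by omega) le_rfl (by omega)).eq,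
    ← mul_assoc]
  exact ⟨_, rfl⟩

theorem mul_row_mul_sub {s m : ℕ} (hN : s + m = N) (hs : s + 2 < N)
    (hv : Quasi N q T E (s + 2) v) :
    v * row q T m s * (T (s + 2) - q • 1) =
      v * row q T m s * (T (s + 1) - q • 1) * E (s + 2) := by
  obtain ⟨m, rfl⟩ : ∃ k, m = k + 3 := ⟨m - 3, by omega⟩
  have e : v * row q T (m + 3) s =
      v * (1 + q • T (s + 1) + q ^ 2 • (T (s + 1) * T (s + 2))) +
      q ^ 3 • (v * T (s + 1) * T (s + 2) * T (s + 3) * row q T m (s + 3)) := by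
    simp only [row, show s + 1 + 1 = s + 2 from rfl, show s + 2 + 1 = s + 3 from rfl]
    simp only [mul_add v, mul_add (_ * _ : A), mul_smul_comm, ← mul_assoc,
      mul_one, smul_add]
    module
  have e1 := h.lower_triple (i := s + 1) (by omega) (by omega) (hv.1 hs)
  simp only [show s + 1 + 1 = s + 2 from rfl] at e1
  rw [e, add_mul, add_mul, add_mul, e1]
  congr 1
  simp only [smul_mul_assoc]
  congr 1
  rcases m with _ | m
  · simp [row]
  have c1 : Commute (T (s + 1) - q • 1) (row q T (m + 1) (s + 3)) :=
    (h.T_comm_row (by omega) (by omega) (by omega)).sub_left ((Commute.one_left _).smul_left q)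
  have c2 : Commute (T (s + 2) - q • 1) (row q T (m + 1) (s + 3)) :=
    (h.T_comm_row (by omega) (by omega) (by omega)).sub_left ((Commute.one_left _).smul_left q)
  have c3 : Commute (E (s + 2)) (row q T (m + 1) (s + 3)) :=
    h.E_comm_row (by omega) (by omega) (by omega)
  have c4 := (h.TT_comm (s + 1) (s + 3) (by omega) (by omega) (by omega) (by omega) (by omega)).eq
  have c5 := (h.TE_comm (s + 1) (s + 3) (by omega) (by omega) (by omega) (by omega) (by omega)).eq
  have b1 := h.braid (s + 1) (by omega) (by omega)
  have b2 := h.braid (s + 2) (by omega) (by omega)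
  have b3 := h.TTE₁ (s + 2) (by omega) (by omega)
  have b4 := h.ETT₁ (s + 2) (by omega) (by omega)
  simp only [show s + 1 + 1 = s + 2 from rfl, show s + 2 + 1 = s + 3 from rfl] at b1 b2 b3 b4
  have d1 : v * T (s + 1) * T (s + 2) * T (s + 3) * (T (s + 2) - q • 1) =
      v * (T (s + 3) - q • 1) * T (s + 1) * T (s + 2) * T (s + 3) := by
    simp only [mul_sub, sub_mul, mul_smul_comm, smul_mul_assoc, mul_one]
    simp only [mul_assoc] at b2 ⊢
    rw [b2, ← mul_assoc (T (s + 1)), c4, mul_assoc]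
  have d2 : v * T (s + 1) * T (s + 2) * T (s + 3) * (T (s + 1) - q • 1) =
      v * (T (s + 2) - q • 1) * T (s + 1) * T (s + 2) * T (s + 3) := by
    simp only [mul_sub, sub_mul, mul_smul_comm, smul_mul_assoc, mul_one]
    congr 1
    simp only [mul_assoc]
    rw [← c4, ← mul_assoc (T (s + 2)), ← mul_assoc (T (s + 1)), ← mul_assoc (T (s + 1)), b1]
    simp only [mul_assoc]
  have d3 := hv.2 (s + 2) le_rfl (by omega)
  have d4 : T (s + 1) * T (s + 2) * T (s + 3) * E (s + 2) =
      E (s + 3) * T (s + 1) * T (s + 2) * T (s + 3) := by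
    rw [← c5]
    simp only [mul_assoc] at b3 b4 ⊢
    rw [b3, b4]
  calc _ = v * (T (s + 3) - q • 1) * T (s + 1) * T (s + 2) * T (s + 3) * row q T (m + 1) (s + 3) := by
        rw [mul_assoc _ _ (T (s + 2) - q • 1), ← c2.eq, ← mul_assoc, d1]
    _ = v * (T (s + 2) - q • 1) * (E (s + 3) * T (s + 1) * T (s + 2) * T (s + 3)) *
          row q T (m + 1) (s + 3) := by
        rw [show s + 3 = s + 2 + 1 from rfl, d3]
        simp only [mul_assoc]
    _ = v * (T (s + 2) - q • 1) * T (s + 1) * T (s + 2) * T (s + 3) * E (s + 2) *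
          row q T (m + 1) (s + 3) := by
        rw [← d4]
        simp only [mul_assoc]
    _ = _ := by
        rw [← d2, mul_assoc _ (row _ _ _ _) (T (s + 1) - q • 1), ← c1.eq, mul_assoc _ (E (s + 2)), c3.eq]
        simp only [mul_assoc]

theorem quasi_mul_row {s m : ℕ} (hN : s + m = N) (hv : Quasi N q T E (s + 2) v) :
    Quasi N q T E (s + 1) (v * row q T m s) := by
  induction m generalizing s v with
  | zero => simpa [row] using Quasi.zero
  | succ m ih =>
    refine Quasi.of_succ ?_ (fun hs => h.arc_mul_row hN hs hv) fun hs => h.mul_row_mul_sub hN hs hv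
    have e := ih (s := s + 1) (v := v * T (s + 1)) (by omega) (hv.succ.mul_right
      (fun j h1 h2 => h.TT_comm _ _ (by omega) (by omega) (by omega) (by omega) (by omega))
      (fun j h1 h2 => (h.TE_comm _ _ (by omega) (by omega) (by omega) (by omega) (by omega)).symm))
    rw [row, mul_add, mul_one, mul_smul_comm, ← mul_assoc]
    exact hv.add (e.smul q)

theorem quasi_symSum {s m : ℕ} (hN : s + m = N) : Quasi N q T E (s + 1) (symSum q T m s) := by
  induction m generalizing s with
  | zero => exact Quasi.of_le (by omega)
  | succ m ih => exact h.quasi_mul_row hN (ih (by omega))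

end Row

section QuasiMatchings

variable (h : BMWRel N q r T E)
include h

theorem arc_mul_desc_mul_matchings {s k f m : ℕ} (hN : s + 3 + m = N) (hk : k ≤ m)
    (hv : Arc E (s + 1) v) :
    v * desc T s (k + 2) * matchings q T f m (s + 3) =
      v * desc T (s + 2) k * matchings q T f m (s + 3) * E (s + 2) := by
  have hp : Arc E (s + 1) (v * desc T (s + 2) k) := hv.mul_right (commute_desc fun j h1 h2 =>
    (h.TE_comm _ _ (by omega) (by omega) (by omega) (by omega) (by omega)).symm)
  have e := h.arc_TT_up (by omega) (by omega) hp
  rw [desc_add_two, mul_assoc _ _ (E (s + 2)),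
    ← (h.E_comm_matchings (f := f) (s := s + 2) (m := m) (i := s + 2)
      (by omega) le_rfl (by omega)).eq, ← mul_assoc _ (E (s + 2)), ← e]
  simp only [mul_assoc]

theorem arc_mul_matchingsPrev {s f n t : ℕ} (hN : s + n ≤ N) (ht : 1 ≤ t) (hts : t ≤ s + 1)
    (hv : f ≠ 0 → 2 * f ≤ n → Arc E t v) : Arc E t (v * matchingsPrev q T f n s) := by
  rcases f with _ | g
  · simpa [matchingsPrev] using Arc.zero
  rcases n with _ | _ | m
  · simpa [matchingsPrev] using Arc.zero
  · simpa [matchingsPrev] using Arc.zero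
  by_cases hm : m < 2 * g
  · simpa [matchingsPrev, matchings_eq_zero q T hm] using Arc.zero
  · exact (hv (by omega) (by omega)).mul_right (h.E_comm_matchings ht hts (by omega))

theorem good_arc_mul_sub {s f n : ℕ} (hn : 2 ≤ n) (hN : s + n = N) (hv : Good N q T E s (f + 1) v) :
    Arc E (s + 1) (v * matchings q T (f + 1) n s * (T (s + 1) - q • 1)) := by
  have e := h.good_lower hn hN hv
  have hq : q ^ (2 * (f + 1) + 1) ≠ 0 := pow_ne_zero _ h.hq
  rw [← one_smul F (_ * _ * _), ← inv_mul_cancel₀ hq, mul_smul, e]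
  refine Arc.smul _ (Arc.add (Arc.smul _ ?_) (Arc.smul _ ?_))
  · exact h.arc_mul_matchingsPrev (by omega) (by omega) le_rfl
      fun _ _ => hv.arcs 0 (by omega)
  · exact h.arc_mul_matchingsPrev (by omega) (by omega) le_rfl
      fun _ _ => (h.good_mul_sub (by omega) hv).arcs 0 (by omega)

theorem good_mul_matchings_mul_sub {s g m : ℕ} (hN : s + m + 3 = N)
    (hv : Good N q T E s (g + 1) v) :
    v * matchings q T (g + 1) (m + 3) s * (T (s + 2) - q • 1) =
      v * matchings q T (g + 1) (m + 3) s * (T (s + 1) - q • 1) * E (s + 2) := by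
  have hq := h.hq
  have hr := h.hr
  have b1 := congrArg (· * E (s + 2)) (h.good_lower (by omega) (by omega) hv (n := m + 3))
  have b2 : q ^ (2 * g + 3) • (v * desc T s (2 * (g + 1)) * matchings q T (g + 1) (m + 2) (s + 1) *
        (T (s + 2) - q • 1)) =
      (q ^ (2 * g + 3) * r⁻¹ - q ^ (2 * (m + 2))) • (v * desc T (s + 2) (2 * g) *
        matchings q T g m (s + 3) * E (s + 2)) +
      q ^ (4 * g + 5) • (v * (T (s + 2 * (g + 1) + 1) - q • 1) * desc T (s + 2) (2 * (g + 1)) *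
        matchings q T (g + 1) m (s + 3) * E (s + 2)) := by
    by_cases hm : m + 2 < 2 * (g + 1)
    · rw [matchings_eq_zero q T hm, matchings_eq_zero q T (show m < 2 * g by omega),
        matchings_eq_zero q T (show m < 2 * (g + 1) by omega)]
      simp
    have e := h.good_lower (s := s + 1) (n := m + 2) (by omega) (by omega)
      (h.good_mul_desc (by omega) hv)
    rw [← h.arc_mul_desc_mul_matchings (by omega) (by omega) (hv.arcs 0 (by omega))]
    refine e.trans ?_
    congr 1
    show q ^ (4 * (g + 1) + 1) • (_ * matchings q T (g + 1) m (s + 3)) = _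
    by_cases hm' : m < 2 * (g + 1)
    · simp [matchings_eq_zero q T hm']
    rw [← h.arc_mul_desc_mul_matchings (by omega) (by omega)
      ((h.good_mul_sub (by omega) hv).arcs 0 (by omega)),
      show s + 1 + 2 * (g + 1) + 1 = s + 2 * (g + 1) + 2 by ring,
      h.good_mul_desc_mul_sub (by omega) hv]
    rfl
  have b3 : v * matchings q T g (m + 1) (s + 2) * (1 + q • T (s + 2)) * (T (s + 2) - q • 1) =
      -((q ^ 2 - 1) * r⁻¹) • (v * matchings q T g (m + 1) (s + 2) * E (s + 2)) :=
    h.mul_one_add_sub (by omega) (by omega) _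
  have b4 : q ^ (2 * g + 1) • (v * matchings q T g (m + 1) (s + 2) * T (s + 2) * T (s + 3) *
        row q T m (s + 3) * (T (s + 2) - q • 1)) =
      (q ^ (2 * g + 1) * r⁻¹ - q ^ (2 * (m + 1))) • (v * matchingsPrev q T g (m + 1) (s + 2) *
        row q T m (s + 3) * E (s + 2)) +
      q ^ (4 * g + 1) • (v * (T (s + 2 * (g + 1) + 1) - q • 1) *
        matchingsPrev q T (g + 1) (m + 1) (s + 2) * row q T m (s + 3) * E (s + 2)) := by
    rcases m with _ | m
    · simp [row]
    have c1 : Commute (T (s + 2)) (row q T (m + 1) (s + 3)) :=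
      h.T_comm_row (by omega) (by omega) (by omega)
    have c2 : Commute (E (s + 2)) (row q T (m + 1) (s + 3)) :=
      h.E_comm_row (by omega) (by omega) (by omega)
    have hb := h.braid (s + 2) (by omega) (by omega)
    have e2 : ∀ y : A, y * T (s + 2) * T (s + 3) * row q T (m + 1) (s + 3) * (T (s + 2) - q • 1) =
        y * (T (s + 3) - q • 1) * T (s + 2) * T (s + 3) * row q T (m + 1) (s + 3) := fun y => by
      have hb' := congrArg (fun x => y * x * row q T (m + 1) (s + 3)) hb
      simp only [← mul_assoc, show s + 2 + 1 = s + 3 from rfl] at hb'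
      rw [mul_sub, mul_assoc _ _ (T (s + 2)), ← c1.eq]
      simp only [← mul_assoc, mul_sub, sub_mul, mul_smul_comm, smul_mul_assoc, mul_one]
      rw [hb']
    have e := h.good_lower (s := s + 2) (n := m + 2) (by omega) (by omega) hv.tail
    have a1 : Arc E (s + 3) (v * matchingsPrev q T g (m + 2) (s + 2)) :=
      h.arc_mul_matchingsPrev (by omega) (by omega) le_rfl
        fun _ _ => hv.arcs 1 (by omega)
    have a2 : Arc E (s + 3) (v * (T (s + 2 * (g + 1) + 1) - q • 1) *
        matchingsPrev q T (g + 1) (m + 2) (s + 2)) :=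
      h.arc_mul_matchingsPrev (by omega) (by omega) le_rfl
        fun _ _ => (h.good_mul_sub (by omega) hv).arcs 1 (by omega)
    have t1 := h.arc_TT_down (i := s + 2) (by omega) (by omega) a1
    have t2 := h.arc_TT_down (i := s + 2) (by omega) (by omega) a2
    simp only [show s + 2 + 1 = s + 3 from rfl, show m + 1 + 1 = m + 2 from rfl,
      show s + 2 + 2 * g + 1 = s + 2 * (g + 1) + 1 by ring] at t1 t2 e ⊢
    have c3 : ∀ y : A, y * row q T (m + 1) (s + 3) * E (s + 2) =
        y * E (s + 2) * row q T (m + 1) (s + 3) := fun y => by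
      rw [mul_assoc, ← c2.eq, ← mul_assoc]
    rw [e2, c3, c3, ← t1, ← t2]
    simp only [← smul_mul_assoc, e, ← add_mul]
  have c2 : Commute (E (s + 2)) (row q T m (s + 3)) :=
      h.E_comm_row (by omega) (by omega) (by omega)
  have hH1 : matchings q T (g + 1) (m + 3) s = q ^ (2 * (g + 1)) • (desc T s (2 * (g + 1)) *
      matchings q T (g + 1) (m + 2) (s + 1)) + matchings q T g (m + 1) (s + 2) *
        (1 + q • (T (s + 2) * (1 + q • (T (s + 3) * row q T m (s + 3))))) :=
    matchings_succ q T (g + 1) (m + 2) s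
  have hH2 : matchings q T g (m + 1) (s + 2) = q ^ (2 * g) • (desc T (s + 2) (2 * g) *
      matchings q T g m (s + 3)) + matchingsPrev q T g (m + 1) (s + 2) * row q T m (s + 3) :=
    matchings_succ q T g m (s + 2)
  have hH3 : matchings q T (g + 1) (m + 1) (s + 2) = q ^ (2 * (g + 1)) • (desc T (s + 2)
      (2 * (g + 1)) * matchings q T (g + 1) m (s + 3)) +
        matchingsPrev q T (g + 1) (m + 1) (s + 2) * row q T m (s + 3) :=
    matchings_succ q T (g + 1) m (s + 2)
  have b5 : q ^ (2 * g + 3) • (v * matchings q T (g + 1) (m + 3) s * (T (s + 2) - q • 1)) =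
      q ^ (2 * g + 2) • (q ^ (2 * g + 3) • (v * desc T s (2 * (g + 1)) *
        matchings q T (g + 1) (m + 2) (s + 1) * (T (s + 2) - q • 1))) +
      q ^ (2 * g + 3) • (v * matchings q T g (m + 1) (s + 2) * (1 + q • T (s + 2)) *
        (T (s + 2) - q • 1)) +
      q ^ 4 • (q ^ (2 * g + 1) • (v * matchings q T g (m + 1) (s + 2) * T (s + 2) * T (s + 3) *
        row q T m (s + 3) * (T (s + 2) - q • 1))) := by
    rw [hH1]
    generalize T (s + 2) - q • 1 = ξ
    simp only [mul_add v, mul_add (_ * _ : A), mul_add (T _), add_mul, mul_smul_comm,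
      smul_mul_assoc, ← mul_assoc, mul_one, smul_add]
    module
  have b6 : v * matchings q T g (m + 1) (s + 2) * E (s + 2) = q ^ (2 * g) • (v *
      desc T (s + 2) (2 * g) * matchings q T g m (s + 3) * E (s + 2)) +
      v * matchingsPrev q T g (m + 1) (s + 2) * row q T m (s + 3) * E (s + 2) := by
    rw [hH2]
    simp only [mul_add v, add_mul, mul_smul_comm, smul_mul_assoc, ← mul_assoc]
  have b7 : ∀ w : A, w * matchings q T (g + 1) (m + 1) (s + 2) * E (s + 2) =
      q ^ (2 * (g + 1)) • (w * desc T (s + 2) (2 * (g + 1)) * matchings q T (g + 1) m (s + 3) *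
        E (s + 2)) +
      w * matchingsPrev q T (g + 1) (m + 1) (s + 2) * row q T m (s + 3) * E (s + 2) := fun w => by
    rw [hH3]
    simp only [mul_add w, add_mul, mul_smul_comm, smul_mul_assoc, ← mul_assoc]
  have hinj := IsSMulRegular.of_ne_zero (M := A) (pow_ne_zero (2 * g + 3) hq)
  apply hinj
  simp only
  rw [b5, b2, b3, b4]
  simp only [show matchingsPrev q T (g + 1) (m + 3) s = matchings q T g (m + 1) (s + 2) from rfl,
    show matchingsPrev q T (g + 1 + 1) (m + 3) s = matchings q T (g + 1) (m + 1) (s + 2) from rfl,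
    add_mul, smul_mul_assoc, b6, b7] at b1 ⊢
  rw [show 2 * g + 3 = 2 * (g + 1) + 1 by ring, b1]
  match_scalars <;> field_simp <;> ring

theorem quasi_mul_matchings {s f n : ℕ} (hN : s + n = N) (hv : Good N q T E s f v) :
    Quasi N q T E (s + 1) (v * matchings q T f n s) := by
  induction n using Nat.strong_induction_on generalizing s f v with
  | _ n ih =>
    rcases f with _ | g
    · simpa using hv.quasi
    rcases n with _ | _ | m
    · simpa [matchings] using Quasi.zero
    · simpa [matchings] using Quasi.zero
    refine Quasi.of_succ ?_ (fun _ => h.good_arc_mul_sub (by omega) hN hv) fun hs => ?_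
    · rw [matchings, mul_add, mul_smul_comm, ← mul_assoc, ← mul_assoc]
      refine Quasi.add (Quasi.smul _ ?_) (h.quasi_mul_row (by omega) ?_)
      · by_cases hm : m + 1 < 2 * (g + 1)
        · simpa [matchings_eq_zero q T hm] using Quasi.zero
        · exact ih (m + 1) (by omega) (by omega) (h.good_mul_desc (by omega) hv)
      · exact ih m (by omega) (by omega) hv.tail
    · obtain ⟨m, rfl⟩ : ∃ k, m = k + 1 := ⟨m - 1, by omega⟩
      exact h.good_mul_matchings_mul_sub (by omega) hv

end QuasiMatchings

/-- The product `x_{s+1} x_{s+3} ⋯ x_{s+2f-1}`. -/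
def oddProd (x : ℕ → A) : ℕ → ℕ → A
  | _, 0 => 1
  | s, f + 1 => x (s + 1) * oddProd x (s + 2) f

/-- The product `x_{s+2f-1} ⋯ x_{s+3} x_{s+1}`. -/
def oddProdRev (x : ℕ → A) : ℕ → ℕ → A
  | _, 0 => 1
  | s, f + 1 => oddProdRev x (s + 2) f * x (s + 1)

theorem oddProd_succ (x : ℕ → A) (s f : ℕ) :
    oddProd x s (f + 1) = oddProd x s f * x (s + 2 * f + 1) := by
  induction f generalizing s with
  | zero => simp [oddProd]
  | succ f ih =>
    rw [oddProd, ih, oddProd, mul_assoc, show s + 2 + 2 * f + 1 = s + 2 * (f + 1) + 1 by ring]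

theorem op_oddProd (x : ℕ → A) (s f : ℕ) :
    MulOpposite.op (oddProd x s f) = oddProdRev (fun i => MulOpposite.op (x i)) s f := by
  induction f generalizing s with
  | zero => simp [oddProd, oddProdRev]
  | succ f ih => rw [oddProd, MulOpposite.op_mul, ih, oddProdRev]

theorem commute_oddProdRev {x : ℕ → A} {s f : ℕ} {y : A}
    (hx : ∀ t < f, Commute y (x (s + 2 * t + 1))) : Commute y (oddProdRev x s f) := by
  induction f generalizing s with
  | zero => simp [oddProdRev]
  | succ f ih =>
    refine (ih fun t ht => ?_).mul_right (hx 0 (by omega))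
    rw [show s + 2 + 2 * t + 1 = s + 2 * (t + 1) + 1 by ring]
    exact hx _ (by omega)

theorem Arcs.cons {s f : ℕ} (h0 : Arc E (s + 1) v) (hv : Arcs E (s + 2) f v) :
    Arcs E s (f + 1) v := fun t ht => by
  rcases t with _ | t
  · exact h0
  · rw [show s + 2 * (t + 1) + 1 = s + 2 + 2 * t + 1 by ring]
    exact hv t (by omega)

section Symmetrizer

variable (h : BMWRel N q r T E)
include h

theorem arcs_oddProdRev {s f : ℕ} (hN : s + 2 * f ≤ N) : Arcs E s f (oddProdRev E s f) := by
  induction f generalizing s with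
  | zero => intro t ht; omega
  | succ f ih =>
    refine Arcs.cons ⟨_, rfl⟩ ((ih (by omega)).mul_right_of_commute fun t ht => ?_)
    exact h.EE_comm _ _ (by omega) (by omega) (by omega) (by omega) (by omega)

theorem oddProdRev_mul_symSum {s f m : ℕ} (hN : s + (2 * f + m) ≤ N) {κ : ℕ → F} (hκ₀ : κ 0 = 1)
    (hκ : ∀ f, κ (f + 1) = -((q ^ (2 * f + 2) - 1) * r⁻¹) * κ f) :
    oddProdRev (fun i => T i - q • 1) s f * symSum q T (2 * f + m) s =
      κ f • (oddProdRev E s f * symSum q T m (s + 2 * f) * matchings q T f (2 * f + m) s) := by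
  induction f generalizing s with
  | zero => simp [oddProdRev, hκ₀]
  | succ f ih =>
    have hc : Commute (E (s + 1)) (oddProdRev (fun i => T i - q • 1) (s + 2) f) :=
      commute_oddProdRev fun t ht => ((h.TE_comm _ _ (by omega) (by omega) (by omega) (by omega)
        (by omega)).symm).sub_right ((Commute.one_right _).smul_right q)
    have hc' : Commute (E (s + 1)) (oddProdRev E (s + 2) f) :=
      commute_oddProdRev fun t ht => h.EE_comm _ _ (by omega) (by omega) (by omega) (by omega)
        (by omega)
    have hv : Arcs E s (f + 1)
        (oddProdRev E s (f + 1) * symSum q T m (s + 2 * (f + 1))) :=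
      (h.arcs_oddProdRev (by omega)).mul_right_of_commute fun t ht => commute_symSum fun j h1 h2 =>
        (h.TE_comm _ _ (by omega) (by omega) (by omega) (by omega) (by omega)).symm
    have e1 := h.matchings_mul_pairs (m := 2 * f + m) (by omega) hv
    have e2 := h.sub_mul_one_add (i := s + 1) (by omega) (by omega) 1
    have e3 := h.symSum_add_two (m := 2 * f + m) (s := s) (by omega)
    have e4 := ih (s := s + 2) (by omega)
    rw [one_mul, one_mul] at e2
    have hsum : (q ^ 2 - 1) * ∑ t ∈ range (f + 1), q ^ (2 * t) = q ^ (2 * f + 2) - 1 := by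
      have := mul_geom_sum (q ^ 2) (f + 1)
      simp only [← pow_mul] at this
      rw [this]
      congr 1
    rw [show 2 * (f + 1) + m = 2 * f + m + 2 by ring, e3, oddProdRev, mul_assoc,
      ← mul_assoc (T (s + 1) - q • 1), e2, smul_mul_assoc, mul_smul_comm, ← mul_assoc, ← hc.eq,
      mul_assoc, ← mul_assoc _ _ (pairs _ _ _ _), e4, smul_mul_assoc, mul_smul_comm,
      show s + 2 + 2 * f = s + 2 * (f + 1) by ring, ← mul_assoc, ← mul_assoc, ← mul_assoc, hc'.eq]
    have e5 : oddProdRev E (s + 2) f * E (s + 1) = oddProdRev E s (f + 1) := rfl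
    rw [e5, e1, smul_smul, smul_smul, hκ f, ← hsum]
    congr 1
    ring

variable {γ : ℕ → F}

theorem good_oddProd {n f : ℕ} {u : A} (hN : n = N) (hf : 2 * f ≤ n) (hu : Quasi N q T E 1 u) :
    Good N q T E 0 f (u * oddProd (fun i => T i - q • 1) 0 f) := by
  induction f with
  | zero => exact ⟨fun t ht => by omega, by simpa [oddProd] using hu⟩
  | succ f ih =>
    rw [oddProd_succ, ← mul_assoc]
    exact h.good_mul_sub (by omega) (ih (by omega))

theorem sum_matchings_mul_sub_one {n K : ℕ} {u : A} (hN : n = N) (hn : 2 ≤ n) (hK : 2 * K ≤ n)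
    (hu : Quasi N q T E 1 u)
    (hγ : ∀ f, 2 * (f + 1) ≤ n →
      γ (f + 1) * (q ^ (2 * n) - q ^ (2 * f + 3) * r⁻¹) = γ f * q ^ (4 * f + 3)) :
    (∑ f ∈ range (K + 1), γ f • (u * oddProd (fun i => T i - q • 1) 0 f * matchings q T f n 0)) *
        (T 1 - q • 1) =
      (γ K * q ^ (2 * K)) • (u * oddProd (fun i => T i - q • 1) 0 (K + 1) *
        matchingsPrev q T (K + 1) n 0) := by
  have hq := h.hq
  have hr := h.hr
  induction K with
  | zero =>
    have e := h.good_lower hn (by omega) (h.good_oddProd (f := 0) hN hK hu)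
    have e0 : matchingsPrev q T 0 n 0 = 0 := by rcases n with _ | _ | n <;> rfl
    simp only [mul_zero, zero_add, pow_one, e0, smul_zero] at e
    have e1 := IsSMulRegular.of_ne_zero (M := A) hq e
    simp only [zero_add, sum_range_one, smul_mul_assoc, e1, mul_zero, pow_zero, mul_one,
      oddProd_succ _ 0 0, ← mul_assoc]
  | succ K ih =>
    have e := h.good_lower hn (by omega) (h.good_oddProd hN hK hu)
    rw [sum_range_succ, add_mul, ih (by omega), oddProd_succ _ 0 (K + 1)]
    simp only [zero_add] at e ⊢
    have e1 := hγ K hK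
    have hc : q ^ (2 * (K + 1) + 1) ≠ 0 := pow_ne_zero _ hq
    apply IsSMulRegular.of_ne_zero (M := A) hc
    simp only [smul_add, smul_mul_assoc]
    rw [smul_comm _ (γ (K + 1)), e, ← mul_assoc u, smul_smul, smul_add, smul_smul, ← add_assoc,
      ← add_smul]
    have e2 : q ^ (2 * (K + 1) + 1) * (γ K * q ^ (2 * K)) +
        γ (K + 1) * (q ^ (2 * (K + 1) + 1) * r⁻¹ - q ^ (2 * n)) = 0 := by
      linear_combination -e1
    rw [e2, zero_smul, zero_add, smul_smul, smul_smul]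
    congr 1
    ring

/-- A combination of matching sums that absorbs all generators. -/
theorem sum_matchings_mul_sub {n i : ℕ} {u : A} (hN : n = N) (hi : 1 ≤ i) (hin : i < n)
    (hu : Quasi N q T E 1 u)
    (hγ : ∀ f, 2 * (f + 1) ≤ n →
      γ (f + 1) * (q ^ (2 * n) - q ^ (2 * f + 3) * r⁻¹) = γ f * q ^ (4 * f + 3)) :
    (∑ f ∈ range (n / 2 + 1), γ f • (u * oddProd (fun i => T i - q • 1) 0 f *
      matchings q T f n 0)) * (T i - q • 1) = 0 := by
  have h0 := h.sum_matchings_mul_sub_one hN (by omega) (K := n / 2) (by omega) hu hγ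
  have hz : matchingsPrev q T (n / 2 + 1) n 0 = 0 := by
    obtain ⟨m, rfl⟩ : ∃ m, n = m + 2 := ⟨n - 2, by omega⟩
    exact matchings_eq_zero q T (by omega) _
  rw [hz, mul_zero, smul_zero] at h0
  have hQ : ∀ K, 2 * K ≤ n → Quasi N q T E 1 (∑ f ∈ range (K + 1),
      γ f • (u * oddProd (fun i => T i - q • 1) 0 f * matchings q T f n 0)) := by
    intro K
    induction K with
    | zero =>
      intro hK
      rw [zero_add, sum_range_one]
      exact (h.quasi_mul_matchings (by omega) (h.good_oddProd hN hK hu)).smul _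
    | succ K ih =>
      intro hK
      rw [sum_range_succ]
      exact (ih (by omega)).add
        ((h.quasi_mul_matchings (by omega) (h.good_oddProd hN hK hu)).smul _)
  have hQ' := (hQ (n / 2) (by omega)).2
  induction i, hi using Nat.le_induction with
  | base => exact h0
  | succ i hi ih => rw [hQ' i hi (by omega), ih (by omega), zero_mul]

end Symmetrizer

end BMWRel

end RelationTheory

section Length

variable {n : ℕ}

theorem sGen_val {i : ℕ} (hi : 1 ≤ i) (hn : i < n) (x : Fin n) :
    (sGen n i x : ℕ) = if (x : ℕ) = i - 1 then i else if (x : ℕ) = i then i - 1 else x := by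
  rw [sGen, dif_pos ⟨hi, hn⟩, Equiv.swap_apply_def]
  simp only [Fin.ext_iff]
  split_ifs <;> rfl

theorem sGen_inv (i : ℕ) : (sGen n i)⁻¹ = sGen n i := by
  rw [sGen]
  split_ifs <;> simp

theorem sGen_sGen (i : ℕ) (x : Fin n) : sGen n i (sGen n i x) = x := by
  nth_rw 1 [← sGen_inv]
  simp

theorem len_one : len (1 : Equiv.Perm (Fin n)) = 0 := by
  rw [len, card_eq_zero, filter_eq_empty_iff]
  rintro ⟨a, b⟩ - ⟨h1, h2⟩
  exact lt_asymm h1 h2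

theorem len_inv (w : Equiv.Perm (Fin n)) : len w⁻¹ = len w := by
  refine card_nbij' (fun p => (w⁻¹ p.2, w⁻¹ p.1)) (fun p => (w p.2, w p.1)) ?_ ?_ ?_ ?_ <;>
    intro p hp <;> simp_all

theorem len_mul_sGen (w : Equiv.Perm (Fin n)) {i : ℕ} (hi : 1 ≤ i) {a b : Fin n}
    (ha : (a : ℕ) + 1 = i) (hb : (b : ℕ) = i) (h : w a < w b) : len (w * sGen n i) = len w + 1 := by
  have hn : i < n := hb ▸ b.2
  have hs := sGen_val (n := n) hi hn
  have sa : sGen n i a = b := Fin.ext (by rw [hs]; split_ifs <;> omega)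
  have sb : sGen n i b = a := Fin.ext (by rw [hs]; split_ifs <;> omega)
  have hmono : ∀ x y : Fin n, x < y → ¬ (x = a ∧ y = b) → sGen n i x < sGen n i y := by
    intro x y h1 h2
    rw [Fin.ext_iff, Fin.ext_iff] at h2
    rw [Fin.lt_def] at h1 ⊢
    rw [hs, hs]
    split_ifs <;> omega
  have hmem : (a, b) ∈ univ.filter (fun p : Fin n × Fin n =>
      p.1 < p.2 ∧ (w * sGen n i) p.2 < (w * sGen n i) p.1) := by
    rw [mem_filter_univ, Equiv.Perm.mul_apply, Equiv.Perm.mul_apply, sa, sb]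
    exact ⟨Fin.lt_def.2 (by simp only; omega), h⟩
  rw [len, len, ← card_erase_add_one hmem]
  congr 1
  refine card_nbij' (fun p => (sGen n i p.1, sGen n i p.2)) (fun p => (sGen n i p.1, sGen n i p.2))
    ?_ ?_ ?_ ?_
  · rintro ⟨x, y⟩ hp
    rw [mem_coe, mem_erase, mem_filter_univ] at hp
    rw [mem_coe, mem_filter_univ]
    exact ⟨hmono x y hp.2.1 (by simpa using hp.1), hp.2.2⟩
  · rintro ⟨x, y⟩ hp
    rw [mem_coe, mem_filter_univ] at hp
    rw [mem_coe, mem_erase, mem_filter_univ]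
    refine ⟨?_, hmono x y hp.1 ?_, by simpa [sGen_sGen] using hp.2⟩
    · rw [Ne, Prod.mk.injEq]
      rintro ⟨h1, h2⟩
      have h3 := congrArg (sGen n i) h1
      have h4 := congrArg (sGen n i) h2
      rw [sGen_sGen, sa] at h3
      rw [sGen_sGen, sb] at h4
      subst h3 h4
      rw [Fin.lt_def] at hp
      omega
    · rintro ⟨rfl, rfl⟩
      exact lt_asymm h hp.2
  · rintro ⟨x, y⟩ -
    simp [sGen_sGen]
  · rintro ⟨x, y⟩ -
    simp [sGen_sGen]

end Length

section Cycles

variable {n : ℕ}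

/-- The cycle `s_{s+1} s_{s+2} ⋯ s_{s+k}`. -/
def cyc (n s : ℕ) : ℕ → Equiv.Perm (Fin n)
  | 0 => 1
  | k + 1 => cyc n s k * sGen n (s + k + 1)

theorem cyc_val {s k : ℕ} (hk : s + k < n) (x : Fin n) : (cyc n s k x : ℕ) =
    if (x : ℕ) < s ∨ s + k < x then (x : ℕ) else if (x : ℕ) = s + k then s else x + 1 := by
  induction k generalizing x with
  | zero =>
    simp only [cyc, Equiv.Perm.one_apply]
    split_ifs <;> omega
  | succ k ih =>
    rw [cyc, Equiv.Perm.mul_apply, ih (by omega), sGen_val (by omega) (by omega)]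
    split_ifs <;> omega

theorem cyc_inv_val {s k : ℕ} (hk : s + k < n) (x : Fin n) : ((cyc n s k)⁻¹ x : ℕ) =
    if (x : ℕ) < s ∨ s + k < x then (x : ℕ) else if (x : ℕ) = s then s + k else x - 1 := by
  have h := cyc_val hk ((cyc n s k)⁻¹ x)
  rw [show cyc n s k ((cyc n s k)⁻¹ x) = x by simp] at h
  split_ifs at h <;> split_ifs <;> omega

theorem len_mul_cyc {s k : ℕ} (hk : s + k < n) {d : Equiv.Perm (Fin n)}
    (hd : ∀ a : Fin n, (a : ℕ) ≤ s → d a = a) : len (d * cyc n s k) = len d + k := by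
  induction k with
  | zero => simp [cyc]
  | succ k ih =>
    have e1 : (d * cyc n s k) ⟨s + k, by omega⟩ = ⟨s, by omega⟩ := by
      have : cyc n s k ⟨s + k, by omega⟩ = ⟨s, by omega⟩ :=
        Fin.ext (by rw [cyc_val (by omega)]; simp)
      rw [Equiv.Perm.mul_apply, this]
      exact hd _ le_rfl
    have e2 : cyc n s k ⟨s + (k + 1), hk⟩ = ⟨s + (k + 1), hk⟩ :=
      Fin.ext (by rw [cyc_val (by omega)]; simp)
    have h : (d * cyc n s k) ⟨s + k, by omega⟩ < (d * cyc n s k) ⟨s + (k + 1), hk⟩ := by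
      rw [e1, Equiv.Perm.mul_apply, e2, Fin.lt_def]
      by_contra hc
      rw [not_lt] at hc
      have h1 := hd _ hc
      have h2 := d.injective h1
      rw [h2] at hc
      simp only at hc
      omega
    rw [cyc, ← mul_assoc, len_mul_sGen _ (by omega) rfl rfl h, ih (by omega)]
    rfl

theorem len_cyc_inv_mul {s k : ℕ} (hk : s + k < n) {d : Equiv.Perm (Fin n)}
    (hd : ∀ a : Fin n, (a : ℕ) ≤ s → d⁻¹ a = a) : len ((cyc n s k)⁻¹ * d) = len d + k := by
  rw [← len_inv, mul_inv_rev, inv_inv, len_mul_cyc hk hd, len_inv]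

theorem len_cyc {s k : ℕ} (hk : s + k < n) : len (cyc n s k) = k := by
  simpa [len_one] using len_mul_cyc (d := 1) hk (by simp)

end Cycles

section Lift

variable {F : Type*} [Field F] {A : Type*} [Ring A] [Algebra F A]
  {n : ℕ} {q : F} {Tw : Equiv.Perm (Fin n) → A} {T : ℕ → A}

/-- `Tw` extends `s_i ↦ T i` multiplicatively along length-additive products. -/
structure IsLift (n : ℕ) (Tw : Equiv.Perm (Fin n) → A) (T : ℕ → A) : Prop where
  one : Tw 1 = 1
  gen : ∀ i, 1 ≤ i → i < n → Tw (sGen n i) = T i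
  mul : ∀ u v, len (u * v) = len u + len v → Tw (u * v) = Tw u * Tw v

theorem len_sGen {i : ℕ} (hi : 1 ≤ i) (hn : i < n) : len (sGen n i) = 1 := by
  have h := len_mul_sGen (1 : Equiv.Perm (Fin n)) hi (a := ⟨i - 1, by omega⟩) (b := ⟨i, hn⟩)
    (by simp only; omega) rfl (by simp only [Equiv.Perm.one_apply, Fin.lt_def]; omega)
  rwa [one_mul, len_one] at h

theorem IsLift.op (h : IsLift n Tw T) :
    IsLift n (fun w => MulOpposite.op (Tw w⁻¹)) (fun i => MulOpposite.op (T i)) where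
  one := by simp [h.one]
  gen i hi hn := by rw [sGen_inv, h.gen i hi hn]
  mul u v huv := by
    rw [mul_inv_rev, h.mul, MulOpposite.op_mul]
    rw [← mul_inv_rev, len_inv, len_inv, len_inv, huv, add_comm]

/-- The product `T (s+1) T (s+2) ⋯ T (s+k)`. -/
def asc (T : ℕ → A) (s : ℕ) : ℕ → A
  | 0 => 1
  | k + 1 => asc T s k * T (s + k + 1)

theorem asc_succ_left (T : ℕ → A) (s k : ℕ) : asc T s (k + 1) = T (s + 1) * asc T (s + 1) k := by
  induction k with
  | zero => simp [asc]
  | succ k ih => rw [asc, ih, asc, mul_assoc, show s + (k + 1) + 1 = s + 1 + k + 1 by omega]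

theorem row_eq_sum (q : F) (T : ℕ → A) (m s : ℕ) :
    row q T m s = ∑ k ∈ range m, q ^ k • asc T s k := by
  induction m generalizing s with
  | zero => rfl
  | succ m ih =>
    rw [row, ih, sum_range_succ', mul_sum, smul_sum, add_comm]
    congr 1
    · refine sum_congr rfl fun k _ => ?_
      rw [asc_succ_left, mul_smul_comm, smul_smul, pow_succ']
    · simp [asc]

theorem IsLift.cyc (h : IsLift n Tw T) {s k : ℕ} (hk : s + k < n) :
    Tw (cyc n s k) = asc T s k := by
  induction k with
  | zero => exact h.one
  | succ k ih =>
    rw [BMWPaper.cyc, h.mul, ih (by omega), h.gen _ (by omega) (by omega), asc]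
    rw [← BMWPaper.cyc, len_cyc hk, len_cyc (by omega), len_sGen (by omega) (by omega)]

theorem IsLift.cyc_inv (h : IsLift n Tw T) {s k : ℕ} (hk : s + k < n) :
    Tw (BMWPaper.cyc n s k)⁻¹ = desc T s k := by
  induction k with
  | zero => simpa [BMWPaper.cyc, desc] using h.one
  | succ k ih =>
    rw [BMWPaper.cyc, mul_inv_rev, sGen_inv, h.mul, ih (by omega), h.gen _ (by omega) (by omega),
      desc]
    rw [← sGen_inv, ← mul_inv_rev, len_inv, len_inv, len_inv, ← BMWPaper.cyc, len_cyc hk,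
      len_cyc (by omega), len_sGen (by omega) (by omega), add_comm]

/-- Factoring a set of permutations over the cosets of the cycles `s_{s+1} ⋯ s_{s+k}`. -/
theorem IsLift.hat_eq_mul_row (h : IsLift n Tw T) {s : ℕ} (hs : s < n)
    {S S' : Finset (Equiv.Perm (Fin n))} (hS : ∀ d ∈ S, ∀ a : Fin n, (a : ℕ) ≤ s → d a = a)
    (h₁ : ∀ d ∈ S, ∀ k, s + k < n → d * BMWPaper.cyc n s k ∈ S')
    (h₂ : ∀ w ∈ S', s ≤ w⁻¹ ⟨s, hs⟩ ∧ ∀ k, (w⁻¹ ⟨s, hs⟩ : ℕ) = s + k →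
      w * (BMWPaper.cyc n s k)⁻¹ ∈ S) :
    hat q Tw S' = hat q Tw S * row q T (n - s) s := by
  rw [hat, hat, row_eq_sum, sum_mul_sum, ← sum_product']
  symm
  refine sum_nbij' (fun p => p.1 * BMWPaper.cyc n s p.2)
    (fun w => (w * (BMWPaper.cyc n s (w⁻¹ ⟨s, hs⟩ - s))⁻¹, w⁻¹ ⟨s, hs⟩ - s)) ?_ ?_ ?_ ?_ ?_
  · rintro ⟨d, k⟩ hp
    rw [mem_product, mem_range] at hp
    exact h₁ d hp.1 k (by have := hp.2; simp only at this; omega)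
  · intro w hw
    obtain ⟨h3, h4⟩ := h₂ w hw
    rw [mem_product, mem_range]
    exact ⟨h4 _ (by omega), by have := (w⁻¹ ⟨s, hs⟩).2; simp only; omega⟩
  · rintro ⟨d, k⟩ hp
    rw [mem_product, mem_range] at hp
    have hk : s + k < n := by have := hp.2; simp only at this; omega
    have e1 : d⁻¹ ⟨s, hs⟩ = ⟨s, hs⟩ := by
      rw [Equiv.Perm.inv_eq_iff_eq]
      exact (hS d hp.1 _ le_rfl).symm
    have e2 : ((d * BMWPaper.cyc n s k)⁻¹ ⟨s, hs⟩ : ℕ) - s = k := by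
      rw [mul_inv_rev, Equiv.Perm.mul_apply, e1, cyc_inv_val hk]
      simp
    simp only [e2, mul_inv_cancel_right]
  · intro w _
    simp
  · rintro ⟨d, k⟩ hp
    rw [mem_product, mem_range] at hp
    have hk : s + k < n := by have := hp.2; simp only at this; omega
    have hl := len_mul_cyc hk (hS d hp.1)
    simp only
    rw [h.mul _ _ (by rw [hl, len_cyc hk]), h.cyc hk, hl, pow_add, smul_mul_smul_comm]

theorem le_apply_of_fix {s : ℕ} {w : Equiv.Perm (Fin n)}
    (h : ∀ a : Fin n, (a : ℕ) < s → w a = a) {x : Fin n} (hx : s ≤ x) : s ≤ w x := by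
  by_contra hc
  have h1 := h (w x) (by omega)
  rw [w.injective h1] at hc
  exact hc hx

theorem mem_fixSet {k : ℕ} {w : Equiv.Perm (Fin n)} :
    w ∈ fixSet n k ↔ ∀ a : Fin n, (a : ℕ) < k → w a = a := by
  classical
  rw [fixSet, mem_filter_univ]

theorem inv_apply_of_fix {s : ℕ} {w : Equiv.Perm (Fin n)}
    (h : ∀ a : Fin n, (a : ℕ) < s → w a = a) (a : Fin n) (ha : (a : ℕ) < s) : w⁻¹ a = a := by
  rw [Equiv.Perm.inv_eq_iff_eq, h a ha]

theorem hat_one (h : IsLift n Tw T) : hat q Tw {1} = 1 := by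
  simp [hat, len_one, h.one]

theorem IsLift.hat_fixSet (h : IsLift n Tw T) {m s : ℕ} (hs : s + m = n) :
    hat q Tw (fixSet n s) = symSum q T m s := by
  induction m generalizing s with
  | zero =>
    have : fixSet n s = {1} := by
      ext w
      rw [mem_fixSet, mem_singleton]
      constructor
      · exact fun hw => Equiv.ext fun a => hw a (by omega)
      · rintro rfl a -
        rfl
    rw [this, hat_one h, symSum]
  | succ m ih =>
    rw [symSum, ← ih (s := s + 1) (by omega), show m + 1 = n - s by omega]
    refine h.hat_eq_mul_row (by omega) ?_ ?_ ?_
    · intro d hd a ha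
      exact mem_fixSet.1 hd a (by omega)
    · intro d hd k hk
      rw [mem_fixSet] at hd ⊢
      intro a ha
      have : BMWPaper.cyc n s k a = a := Fin.ext (by rw [cyc_val hk, if_pos (Or.inl ha)])
      rw [Equiv.Perm.mul_apply, this, hd a (by omega)]
    · intro w hw
      rw [mem_fixSet] at hw
      refine ⟨le_apply_of_fix (inv_apply_of_fix hw) le_rfl, fun k hk => ?_⟩
      have hk' : s + k < n := by have := (w⁻¹ ⟨s, by omega⟩).2; omega
      rw [mem_fixSet]
      intro a ha
      rw [Equiv.Perm.mul_apply]
      rcases Nat.lt_succ_iff_lt_or_eq.1 ha with ha | ha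
      · have : (BMWPaper.cyc n s k)⁻¹ a = a := Fin.ext (by rw [cyc_inv_val hk', if_pos (Or.inl ha)])
        rw [this, hw a ha]
      · have h1 : (BMWPaper.cyc n s k)⁻¹ a = w⁻¹ ⟨s, by omega⟩ :=
          Fin.ext (by rw [cyc_inv_val hk', hk, if_neg (by omega), if_pos ha])
        rw [h1]
        exact Fin.ext (by simp [ha])

end Lift

section Shapes

variable {F : Type*} [Field F] {A : Type*} [Ring A] [Algebra F A]
  {n : ℕ} {q : F} {Tw : Equiv.Perm (Fin n) → A} {T : ℕ → A}

/-- The order relations imposed on the images of the points `s, s+1, …` by `f` pairs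
`(s+2t, s+2t+1)` with increasing left ends, followed by an increasing tail. -/
def ShapeRel (s f x y : ℕ) : Prop :=
  (∃ t < f, x = s + 2 * t ∧ y = s + 2 * t + 1) ∨
    (∃ t u, t < u ∧ u < f ∧ x = s + 2 * t ∧ y = s + 2 * u) ∨ (s + 2 * f ≤ x ∧ x < y)

/-- `g` fixes the points below `s` and respects `ShapeRel s f`. -/
def HasShape (s f : ℕ) (g : Equiv.Perm (Fin n)) : Prop :=
  s + 2 * f ≤ n ∧ (∀ a : Fin n, (a : ℕ) < s → g a = a) ∧
    ∀ a b : Fin n, ShapeRel s f a b → g a < g b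

open scoped Classical in
/-- The permutations whose inverse has shape `(s, f)`. -/
noncomputable def shapeSet (n s f : ℕ) : Finset (Equiv.Perm (Fin n)) :=
  univ.filter fun w => HasShape s f w⁻¹

theorem mem_shapeSet {s f : ℕ} {w : Equiv.Perm (Fin n)} :
    w ∈ shapeSet n s f ↔ HasShape s f w⁻¹ := by
  classical
  rw [shapeSet, mem_filter_univ]

theorem ShapeRel.le_left {s f x y : ℕ} (h : ShapeRel s f x y) : s ≤ x ∧ x < y := by
  rcases h with ⟨t, -, rfl, rfl⟩ | ⟨t, u, h, -, rfl, rfl⟩ | h <;> omega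

theorem ShapeRel.pred {s f x y : ℕ} (h : ShapeRel (s + 1) f x y) :
    (y ≤ s + 2 * f ∧ ShapeRel s f (x - 1) (y - 1)) ∨ (s + 2 * f < x ∧ x < y) := by
  rcases h with ⟨t, h, rfl, rfl⟩ | ⟨t, u, h, h', rfl, rfl⟩ | h
  · exact Or.inl ⟨by omega, Or.inl ⟨t, h, by omega, by omega⟩⟩
  · exact Or.inl ⟨by omega, Or.inr (Or.inl ⟨t, u, h, h', by omega, by omega⟩)⟩
  · exact Or.inr (by omega)

theorem ShapeRel.succ {s f x y : ℕ} (h : ShapeRel s f x y) :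
    (y < s + 2 * f ∧ ShapeRel (s + 1) f (x + 1) (y + 1)) ∨ (s + 2 * f ≤ x ∧ x < y) := by
  rcases h with ⟨t, h, rfl, rfl⟩ | ⟨t, u, h, h', rfl, rfl⟩ | h
  · exact Or.inl ⟨by omega, Or.inl ⟨t, h, by omega, by omega⟩⟩
  · exact Or.inl ⟨by omega, Or.inr (Or.inl ⟨t, u, h, h', by omega, by omega⟩)⟩
  · exact Or.inr (by omega)

theorem ShapeRel.eq_or_add_two {s f x y : ℕ} (h : ShapeRel s (f + 1) x y) :
    x = s ∨ ShapeRel (s + 2) f x y := by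
  rcases h with ⟨t, h, rfl, rfl⟩ | ⟨t, u, h, h', rfl, rfl⟩ | h
  · rcases t with _ | t
    · exact Or.inl (by omega)
    · exact Or.inr (Or.inl ⟨t, by omega, by omega, by omega⟩)
  · rcases t with _ | t
    · exact Or.inl (by omega)
    · exact Or.inr (Or.inr (Or.inl ⟨t, u - 1, by omega, by omega, by omega, by omega⟩))
  · exact Or.inr (Or.inr (Or.inr (by omega)))

theorem ShapeRel.of_add_two {s f x y : ℕ} (h : ShapeRel (s + 2) f x y) :
    ShapeRel s (f + 1) x y := by
  rcases h with ⟨t, h, rfl, rfl⟩ | ⟨t, u, h, h', rfl, rfl⟩ | h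
  · exact Or.inl ⟨t + 1, by omega, by omega, by omega⟩
  · exact Or.inr (Or.inl ⟨t + 1, u + 1, by omega, by omega, by omega, by omega⟩)
  · exact Or.inr (Or.inr (by omega))

theorem ShapeRel.exists_lt {s f x : ℕ} (h : s < x) (h' : x ≠ s + 2 * f) :
    ∃ y, y < x ∧ ShapeRel s f y x := by
  by_cases h1 : s + 2 * f ≤ x
  · exact ⟨s + 2 * f, by omega, Or.inr (Or.inr (by omega))⟩
  · obtain ⟨t, ht | ht⟩ : ∃ t, x = s + 2 * t ∨ x = s + 2 * t + 1 := ⟨(x - s) / 2, by omega⟩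
    · exact ⟨s, h, Or.inr (Or.inl ⟨0, t, by omega, by omega, by omega, ht⟩)⟩
    · exact ⟨s + 2 * t, by omega, Or.inl ⟨t, by omega, rfl, ht⟩⟩

theorem HasShape.apply_first {s f : ℕ} {g : Equiv.Perm (Fin n)} (h : HasShape s f g)
    (hs : s < n) (hne : ∀ x : Fin n, (x : ℕ) = s + 2 * f → g x ≠ ⟨s, hs⟩) :
    g ⟨s, hs⟩ = ⟨s, hs⟩ := by
  obtain ⟨x, hx⟩ := g.surjective ⟨s, hs⟩
  have hsx : s ≤ x := by
    by_contra hc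
    have h1 := h.2.1 x (by omega)
    rw [hx] at h1
    rw [← h1] at hc
    exact hc le_rfl
  rcases hsx.eq_or_lt with h1 | h1
  · have : x = ⟨s, hs⟩ := Fin.ext h1.symm
    rwa [this] at hx
  · obtain ⟨y, hy, hr⟩ := ShapeRel.exists_lt h1 (fun hc => hne x hc hx)
    have h2 := h.2.2 ⟨y, by omega⟩ x hr
    have h3 := le_apply_of_fix h.2.1 (x := ⟨y, by omega⟩) hr.le_left.1
    rw [hx, Fin.lt_def] at h2
    simp only at h2
    omega

theorem hasShape_mul_cyc {s f : ℕ} (hs : s + 2 * f < n) {g : Equiv.Perm (Fin n)}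
    (h : HasShape (s + 1) f g) : HasShape s f (g * cyc n s (2 * f)) := by
  refine ⟨by omega, fun a ha => ?_, fun a b hab => ?_⟩
  · have : cyc n s (2 * f) a = a := Fin.ext (by rw [cyc_val hs, if_pos (Or.inl ha)])
    rw [Equiv.Perm.mul_apply, this, h.2.1 a (by omega)]
  · rw [Equiv.Perm.mul_apply, Equiv.Perm.mul_apply]
    have h1 := hab.le_left
    have ea := cyc_val hs a
    have eb := cyc_val hs b
    rcases hab.succ with ⟨h2, h3⟩ | h2
    · rw [if_neg (by omega), if_neg (by omega)] at ea eb
      exact h.2.2 _ _ (by rwa [ea, eb])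
    · rw [if_pos (by omega)] at eb
      rcases h2.1.eq_or_lt with h3 | h3
      · rw [if_neg (by omega), if_pos (by omega)] at ea
        have h4 := h.2.1 _ (by omega : (cyc n s (2 * f) a : ℕ) < s + 1)
        have h5 := le_apply_of_fix h.2.1 (x := cyc n s (2 * f) b) (by omega)
        rw [h4, Fin.lt_def]
        omega
      · rw [if_pos (by omega)] at ea
        exact h.2.2 _ _ (Or.inr (Or.inr (by omega)))

theorem hasShape_mul_cyc_inv {s f : ℕ} (hs : s + 2 * f < n) {g : Equiv.Perm (Fin n)}
    (h : HasShape s f g) (hg : g ⟨s + 2 * f, hs⟩ = ⟨s, by omega⟩) :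
    HasShape (s + 1) f (g * (cyc n s (2 * f))⁻¹) := by
  refine ⟨by omega, fun a ha => ?_, fun a b hab => ?_⟩
  · rw [Equiv.Perm.mul_apply]
    rcases Nat.lt_succ_iff_lt_or_eq.1 ha with ha | ha
    · have : (cyc n s (2 * f))⁻¹ a = a := Fin.ext (by rw [cyc_inv_val hs, if_pos (Or.inl ha)])
      rw [this, h.2.1 a ha]
    · have : (cyc n s (2 * f))⁻¹ a = ⟨s + 2 * f, hs⟩ :=
        Fin.ext (by rw [cyc_inv_val hs, if_neg (by omega), if_pos ha])
      rw [this, hg]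
      exact Fin.ext ha.symm
  · rw [Equiv.Perm.mul_apply, Equiv.Perm.mul_apply]
    have h1 := hab.le_left
    have ea := cyc_inv_val hs a
    have eb := cyc_inv_val hs b
    refine h.2.2 _ _ ?_
    rcases hab.pred with ⟨h2, h3⟩ | h2
    · rw [if_neg (by omega), if_neg (by omega)] at ea eb
      rwa [ea, eb]
    · rw [if_pos (by omega)] at ea eb
      exact Or.inr (Or.inr (by omega))

theorem hasShape_cyc_inv_mul {s f k : ℕ} (hk : s + 1 + k < n) {g : Equiv.Perm (Fin n)}
    (h : HasShape (s + 2) f g) : HasShape s (f + 1) ((cyc n (s + 1) k)⁻¹ * g) ∧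
      ((cyc n (s + 1) k)⁻¹ * g) ⟨s, by omega⟩ = ⟨s, by omega⟩ := by
  have hfix : ∀ a : Fin n, (a : ℕ) ≤ s → ((cyc n (s + 1) k)⁻¹ * g) a = a := fun a ha => by
    rw [Equiv.Perm.mul_apply, h.2.1 a (by omega)]
    exact Fin.ext (by rw [cyc_inv_val hk, if_pos (by omega)])
  refine ⟨⟨by have := h.1; omega, fun a ha => hfix a ha.le, fun a b hab => ?_⟩, hfix _ le_rfl⟩
  have h1 := hab.le_left
  rcases hab.eq_or_add_two with h2 | h2
  · rw [hfix a (by omega)]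
    have h3 := le_apply_of_fix (s := s + 1) (fun c hc => hfix c (by omega)) (x := b) (by omega)
    exact Fin.lt_def.2 (by omega)
  · have h3 := h.2.2 _ _ h2
    have h4 := h2.le_left
    have h5 := le_apply_of_fix h.2.1 (x := a) (by omega)
    have h6 := le_apply_of_fix h.2.1 (x := b) (by omega)
    rw [Fin.lt_def] at h3 ⊢
    rw [Equiv.Perm.mul_apply, Equiv.Perm.mul_apply, cyc_inv_val hk, cyc_inv_val hk]
    split_ifs <;> omega

theorem hasShape_cyc_mul {s f k : ℕ} (hk : s + 1 + k < n) {g : Equiv.Perm (Fin n)}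
    (h : HasShape s (f + 1) g) (hg : ∀ a : Fin n, (a : ℕ) ≤ s → g a = a)
    (hgk : (g ⟨s + 1, by omega⟩ : ℕ) = s + 1 + k) : HasShape (s + 2) f (cyc n (s + 1) k * g) := by
  refine ⟨by have := h.1; omega, fun a ha => ?_, fun a b hab => ?_⟩
  · rw [Equiv.Perm.mul_apply]
    refine Fin.ext ?_
    rw [cyc_val hk]
    rcases Nat.lt_succ_iff_lt_or_eq.1 ha with ha | ha
    · rw [hg a (by omega), if_pos (by omega)]
    · have : a = ⟨s + 1, by omega⟩ := Fin.ext ha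
      rw [this, hgk, if_neg (by omega), if_pos rfl]
  · have h1 := hab.le_left
    have h2 := h.2.2 _ _ hab.of_add_two
    have h3 : ∀ x : Fin n, s + 2 ≤ x → (g x : ℕ) ≠ s + 1 + k ∧ s + 1 ≤ g x := fun x hx => by
      refine ⟨fun hc => ?_, le_apply_of_fix (fun c hc => hg c (by omega)) (by omega)⟩
      have h4 := g.injective (Fin.ext (hc.trans hgk.symm))
      rw [h4] at hx
      simp only at hx
      omega
    have h4 := h3 a (by omega)
    have h5 := h3 b (by omega)
    rw [Fin.lt_def] at h2 ⊢
    rw [Equiv.Perm.mul_apply, Equiv.Perm.mul_apply, cyc_val hk, cyc_val hk]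
    split_ifs <;> omega

theorem shapeSet_eq_empty {s f : ℕ} (h : n < s + 2 * f) : shapeSet n s f = ∅ := by
  refine eq_empty_of_forall_notMem fun w hw => ?_
  have := (mem_shapeSet.1 hw).1
  omega

theorem IsLift.hat_shapeSet_first (h : IsLift n Tw T) {s f : ℕ} (hs : s + 2 * f < n)
    {S : Finset (Equiv.Perm (Fin n))}
    (hS : ∀ w, w ∈ S ↔ HasShape s f w⁻¹ ∧ w⁻¹ ⟨s + 2 * f, hs⟩ = ⟨s, by omega⟩) :
    hat q Tw S = q ^ (2 * f) • (desc T s (2 * f) * hat q Tw (shapeSet n (s + 1) f)) := by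
  rw [hat, hat, mul_sum, smul_sum]
  symm
  have hcyc : ∀ w : Equiv.Perm (Fin n), (BMWPaper.cyc n s (2 * f) * w)⁻¹ =
      w⁻¹ * (BMWPaper.cyc n s (2 * f))⁻¹ := fun w => mul_inv_rev _ _
  refine sum_nbij' (fun d => (BMWPaper.cyc n s (2 * f))⁻¹ * d)
    (fun w => BMWPaper.cyc n s (2 * f) * w) ?_ ?_ ?_ ?_ ?_
  · intro d hd
    rw [mem_shapeSet] at hd
    rw [hS, mul_inv_rev, inv_inv]
    refine ⟨hasShape_mul_cyc hs hd, ?_⟩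
    have : BMWPaper.cyc n s (2 * f) ⟨s + 2 * f, hs⟩ = ⟨s, by omega⟩ :=
      Fin.ext (by rw [cyc_val hs]; simp)
    rw [Equiv.Perm.mul_apply, this, hd.2.1 _ (Nat.lt_succ_self s)]
  · intro w hw
    rw [hS] at hw
    rw [mem_shapeSet, hcyc]
    exact hasShape_mul_cyc_inv hs hw.1 hw.2
  · intro d _
    simp
  · intro w _
    simp
  · intro d hd
    rw [mem_shapeSet] at hd
    have hl := len_cyc_inv_mul hs (d := d) (fun a ha => hd.2.1 a (by omega))
    rw [h.mul _ _ (by rw [hl, len_inv, len_cyc hs, add_comm]), h.cyc_inv hs, hl, mul_smul_comm,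
      smul_smul, pow_add, mul_comm]

theorem IsLift.hat_shapeSet_last (h : IsLift n Tw T) {s f : ℕ} (hs : s + 1 < n)
    {S : Finset (Equiv.Perm (Fin n))}
    (hS : ∀ w, w ∈ S ↔ HasShape s (f + 1) w⁻¹ ∧ w⁻¹ ⟨s, by omega⟩ = ⟨s, by omega⟩) :
    hat q Tw S = hat q Tw (shapeSet n (s + 2) f) * row q T (n - (s + 1)) (s + 1) := by
  refine h.hat_eq_mul_row hs ?_ ?_ ?_
  · intro d hd a ha
    have := inv_apply_of_fix (mem_shapeSet.1 hd).2.1 a (by omega)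
    rwa [inv_inv] at this
  · intro d hd k hk
    rw [hS, mul_inv_rev]
    exact hasShape_cyc_inv_mul hk (mem_shapeSet.1 hd)
  · intro w hw
    rw [hS] at hw
    have hfix : ∀ a : Fin n, (a : ℕ) < s + 1 → w⁻¹ a = a := fun a ha => by
      rcases Nat.lt_succ_iff_lt_or_eq.1 ha with ha | ha
      · exact hw.1.2.1 a ha
      · have : a = ⟨s, by omega⟩ := Fin.ext ha
        rw [this, hw.2]
    refine ⟨le_apply_of_fix hfix le_rfl, fun k hk => ?_⟩
    rw [mem_shapeSet, mul_inv_rev, inv_inv]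
    exact hasShape_cyc_mul (by have := (w⁻¹ ⟨s + 1, hs⟩).2; omega) hw.1
      (fun a ha => hfix a (by omega)) hk

theorem IsLift.hat_shapeSet (h : IsLift n Tw T) (f m s : ℕ) (hs : s + m = n) :
    hat q Tw (shapeSet n s f) = matchings q T f m s := by
  classical
  induction m using Nat.strong_induction_on generalizing f s with
  | _ m ih =>
  rcases m with _ | m
  · rcases f with _ | f
    · have : shapeSet n s 0 = {1} := by
        ext w
        rw [mem_shapeSet, mem_singleton, ← inv_eq_one]
        constructor
        · exact fun hw => Equiv.ext fun a => hw.2.1 a (by omega)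
        · intro hw
          rw [hw]
          exact ⟨by omega, fun a _ => rfl, fun a b hab => Fin.lt_def.2 hab.le_left.2⟩
      rw [this, hat_one h, matchings_zero]
    · rw [shapeSet_eq_empty (by omega), matchings_eq_zero q T (by omega)]
      simp [hat]
  rw [matchings_succ]
  by_cases hlt : n < s + 2 * f
  · rw [shapeSet_eq_empty hlt, ← matchings_succ, matchings_eq_zero q T (by omega)]
    simp [hat]
  have hsplit : hat q Tw (shapeSet n s f) =
      hat q Tw ((shapeSet n s f).filter fun w => ∃ x : Fin n, (x : ℕ) = s + 2 * f ∧ (w⁻¹ x : ℕ) = s) +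
      hat q Tw ((shapeSet n s f).filter
        fun w => ¬ ∃ x : Fin n, (x : ℕ) = s + 2 * f ∧ (w⁻¹ x : ℕ) = s) :=
    (sum_filter_add_sum_filter_not _ _ _).symm
  rw [hsplit]
  congr 1
  · rw [← ih m (by omega) f (s + 1) (by omega)]
    by_cases heq : n = s + 2 * f
    · rw [shapeSet_eq_empty (s := s + 1) (by omega), filter_false_of_mem]
      · simp [hat]
      · rintro w - ⟨x, hx, -⟩
        exact absurd x.2 (by omega)
    · refine h.hat_shapeSet_first (by omega) fun w => ?_
      rw [mem_filter, mem_shapeSet]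
      refine and_congr_right fun _ => ⟨?_, fun hw => ⟨_, rfl, by rw [hw]⟩⟩
      rintro ⟨x, hx, hw⟩
      have : x = ⟨s + 2 * f, by omega⟩ := Fin.ext hx
      rw [← this]
      exact Fin.ext hw
  · rcases f with _ | f
    · rw [filter_false_of_mem]
      · simp [hat, matchingsPrev]
      · intro w hw
        rw [not_not]
        refine ⟨⟨s, by omega⟩, rfl, ?_⟩
        by_contra hc
        refine hc (congrArg Fin.val ((mem_shapeSet.1 hw).apply_first (by omega) fun x hx hx' => hc ?_))
        have : x = ⟨s, by omega⟩ := Fin.ext hx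
        rw [← this, hx']
    · obtain ⟨m, rfl⟩ : ∃ k, m = k + 1 := ⟨m - 1, by omega⟩
      rw [matchingsPrev, ← ih m (by omega) f (s + 2) (by omega), show m + 1 = n - (s + 1) by omega]
      refine h.hat_shapeSet_last (by omega) fun w => ?_
      rw [mem_filter, mem_shapeSet]
      refine and_congr_right fun hw => ⟨fun hx => ?_, ?_⟩
      · exact hw.apply_first (by omega) fun x hx1 hx2 => hx ⟨x, hx1, by rw [hx2]⟩
      · rintro hw' ⟨x, hx, hx'⟩
        have h1 : w⁻¹ x = w⁻¹ ⟨s, by omega⟩ := by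
          rw [hw']
          exact Fin.ext hx'
        have h2 := congrArg Fin.val (w⁻¹.injective h1)
        simp only at h2
        omega

theorem pimg_eq (d : Equiv.Perm (Fin n)) {x : ℕ} (hx : x < n) :
    pimg d (x + 1) = (d⁻¹ ⟨x, hx⟩ : ℕ) + 1 := by
  rw [pimg, dif_pos (by simpa using hx)]
  rfl

theorem Hset_eq_shapeSet {f : ℕ} (hf : 2 * f ≤ n) : Hset n f = shapeSet n 0 f := by
  classical
  ext d
  rw [mem_shapeSet]
  refine (@mem_filter _ _ (_) _ _).trans ⟨?_, ?_⟩
  · rintro ⟨-, h1, h2, h3⟩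
    refine ⟨by omega, fun a ha => by omega, fun a b hab => ?_⟩
    rw [Fin.lt_def]
    have key : ∀ x (hx : x < n), (d⁻¹ ⟨x, hx⟩ : ℕ) + 1 = pimg d (x + 1) :=
      fun x hx => (pimg_eq d hx).symm
    have h1' : ∀ t u, t < u → u < f → pimg d (2 * t + 1) < pimg d (2 * u + 1) := by
      intro t u htu hu
      induction u, htu using Nat.le_induction with
      | base =>
        exact h1 (t + 1) (mem_Icc.2 (by omega))
      | succ u htu ih =>
        exact (ih (by omega)).trans (h1 (u + 1) (mem_Icc.2 (by omega)))
    have h3' : ∀ x y, 2 * f ≤ x → x < y → y < n → pimg d (x + 1) < pimg d (y + 1) := by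
      intro x y hx hxy hy
      induction y, hxy using Nat.le_induction with
      | base =>
        exact h3 (x + 1) (mem_Icc.2 (by omega))
      | succ y hxy ih =>
        exact (ih (by omega)).trans (h3 (y + 1) (mem_Icc.2 (by omega)))
    rw [← Nat.add_lt_add_iff_right (k := 1), key a a.2, key b b.2]
    rcases hab with ⟨t, ht, ha, hb⟩ | ⟨t, u, htu, hu, ha, hb⟩ | hab
    · rw [ha, hb, zero_add]
      exact h2 (t + 1) (mem_Icc.2 (by omega))
    · rw [ha, hb, zero_add, zero_add]
      exact h1' t u htu hu
    · exact h3' a b (by omega) hab.2 b.2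
  · rintro ⟨-, -, h⟩
    have key : ∀ x y, y < n → ShapeRel 0 f x y → pimg d (x + 1) < pimg d (y + 1) := by
      intro x y hy hxy
      have hx : x < n := hxy.le_left.2.trans hy
      rw [pimg_eq d hx, pimg_eq d hy, Nat.add_lt_add_iff_right]
      exact h ⟨x, hx⟩ ⟨y, hy⟩ hxy
    refine ⟨mem_univ _, fun i hi => ?_, fun i hi => ?_, fun j hj => ?_⟩
    · rw [mem_Icc] at hi
      obtain ⟨t, rfl⟩ : ∃ t, i = t + 1 := ⟨i - 1, by omega⟩
      exact key (2 * t) (2 * (t + 1)) (by omega)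
        (Or.inr (Or.inl ⟨t, t + 1, by omega, by omega, by omega, by omega⟩))
    · rw [mem_Icc] at hi
      obtain ⟨t, rfl⟩ : ∃ t, i = t + 1 := ⟨i - 1, by omega⟩
      exact key (2 * t) (2 * t + 1) (by omega) (Or.inl ⟨t, by omega, by omega, by omega⟩)
    · rw [mem_Icc] at hj
      obtain ⟨t, rfl⟩ : ∃ t, j = t + 1 := ⟨j - 1, by omega⟩
      exact key t (t + 1) (by omega) (Or.inr (Or.inr (by omega)))

end Shapes

section Symmetrizer

variable {F : Type*} [Field F] {A : Type*} [Ring A] [Algebra F A] {n : ℕ} {q r : F}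

theorem BMWRel.op {N : ℕ} {T E : ℕ → A} (h : BMWRel N q r T E) :
    BMWRel N q r (fun i => MulOpposite.op (T i)) (fun i => MulOpposite.op (E i)) where
  hq := h.hq
  hr := h.hr
  sq i h1 h2 := by simpa using congrArg MulOpposite.op (h.sq i h1 h2)
  ET i h1 h2 := congrArg MulOpposite.op (h.TE i h1 h2)
  TE i h1 h2 := congrArg MulOpposite.op (h.ET i h1 h2)
  TT_comm i j h1 h2 h3 h4 h5 := (h.TT_comm i j h1 h2 h3 h4 h5).op
  TE_comm i j h1 h2 h3 h4 h5 := (h.TE_comm i j h1 h2 h3 h4 h5).op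
  EE_comm i j h1 h2 h3 h4 h5 := (h.EE_comm i j h1 h2 h3 h4 h5).op
  braid i h1 h2 := by simpa [mul_assoc] using congrArg MulOpposite.op (h.braid i h1 h2)
  EEE₁ i h1 h2 := by simpa [mul_assoc] using congrArg MulOpposite.op (h.EEE₁ i h1 h2)
  EEE₂ i h1 h2 := by simpa [mul_assoc] using congrArg MulOpposite.op (h.EEE₂ i h1 h2)
  TTE₁ i h1 h2 := by simpa [mul_assoc] using congrArg MulOpposite.op (h.ETT₂ i h1 h2)
  TTE₂ i h1 h2 := by simpa [mul_assoc] using congrArg MulOpposite.op (h.ETT₁ i h1 h2)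
  ETT₁ i h1 h2 := by simpa [mul_assoc] using congrArg MulOpposite.op (h.TTE₂ i h1 h2)
  ETT₂ i h1 h2 := by simpa [mul_assoc] using congrArg MulOpposite.op (h.TTE₁ i h1 h2)
  ETE₁ i h1 h2 := by simpa [mul_assoc] using congrArg MulOpposite.op (h.ETE₁ i h1 h2)
  ETE₂ i h1 h2 := by simpa [mul_assoc] using congrArg MulOpposite.op (h.ETE₂ i h1 h2)

theorem BMWData.semiconjBy_E (D : BMWData F A n q r) {i j : ℕ} (hi : 1 ≤ i) (hi' : i ≤ n - 1)
    (hj : 1 ≤ j) (hj' : j ≤ n - 1) {a : A} (h : SemiconjBy a (D.T i) (D.T j)) :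
    SemiconjBy a (D.E i) (D.E j) := by
  have hinv : a * D.Tinv i = D.Tinv j * a := by
    calc a * D.Tinv i = D.Tinv j * D.T j * a * D.Tinv i := by rw [D.Tinv_mul_T j hj hj', one_mul]
      _ = D.Tinv j * (a * D.T i) * D.Tinv i := by rw [h.eq, mul_assoc (D.Tinv j)]
      _ = D.Tinv j * a := by rw [mul_assoc, mul_assoc, D.T_mul_Tinv i hi hi', mul_one]
  apply IsSMulRegular.of_ne_zero (M := A) D.hqq
  have h1 := congrArg (a * ·) (D.skein i hi hi')
  have h2 := congrArg (· * a) (D.skein j hj hj')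
  have h3 := h.eq
  simp only [mul_sub, sub_mul, mul_smul_comm, smul_mul_assoc, mul_one, one_mul] at h1 h2
  simp only
  linear_combination (norm := module) h1 - h2 - h3 + hinv

theorem BMWData.bmwRel (D : BMWData F A n q r) (hn : 1 ≤ n) : BMWRel n q r D.T D.E where
  hq := D.hq
  hr := D.hr
  sq i h1 h2 := by
    have h := congrArg (D.T i * ·) (D.skein i h1 (by omega))
    simp only [mul_sub, mul_smul_comm, mul_one, D.T_mul_Tinv i h1 (by omega),
      D.TE i h1 (by omega)] at h
    linear_combination (norm := module) h
  ET i h1 h2 := D.ET i h1 (by omega)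
  TE i h1 h2 := D.TE i h1 (by omega)
  TT_comm i j h1 h2 h3 h4 h5 := D.T_comm i j h1 (by omega) h3 (by omega) h5
  TE_comm i j h1 h2 h3 h4 h5 := D.semiconjBy_E h3 (by omega) h3 (by omega)
    (D.T_comm i j h1 (by omega) h3 (by omega) h5)
  EE_comm i j h1 h2 h3 h4 h5 :=
    D.semiconjBy_E h3 (by omega) h3 (by omega) (Commute.symm (D.semiconjBy_E h1 (by omega) h1
      (by omega) (D.T_comm j i h3 (by omega) h1 (by omega) h5.symm)))
  braid i h1 h2 := D.braid i h1 (by omega)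
  EEE₁ i h1 h2 := D.EEE₁ i h1 (by omega)
  EEE₂ i h1 h2 := D.EEE₂ i h1 (by omega)
  TTE₁ i h1 h2 := D.TTE₁ i h1 (by omega)
  TTE₂ i h1 h2 := D.TTE₂ i h1 (by omega)
  ETT₁ i h1 h2 := by
    have h : SemiconjBy (D.T i * D.T (i + 1)) (D.T i) (D.T (i + 1)) := by
      rw [SemiconjBy, D.braid i h1 (by omega), mul_assoc]
    rw [mul_assoc, ← D.TTE₁ i h1 (by omega),
      (D.semiconjBy_E h1 (by omega) (by omega) (by omega) h).eq]
  ETT₂ i h1 h2 := by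
    have h : SemiconjBy (D.T (i + 1) * D.T i) (D.T (i + 1)) (D.T i) := by
      rw [SemiconjBy, ← D.braid i h1 (by omega), mul_assoc]
    rw [mul_assoc, ← D.TTE₂ i h1 (by omega),
      (D.semiconjBy_E (by omega) (by omega) h1 (by omega) h).eq]
  ETE₁ i h1 h2 := D.ETE₁ i h1 (by omega)
  ETE₂ i h1 h2 := D.ETE₂ i h1 (by omega)

theorem BMWData.isLift (D : BMWData F A n q r) : IsLift n D.Tw D.T where
  one := D.Tw_one
  gen i h1 h2 := D.Tw_s i h1 (by omega)
  mul := D.Tw_mul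

theorem op_hat_inv (Tw : Equiv.Perm (Fin n) → A) {S S' : Finset (Equiv.Perm (Fin n))}
    (hS : ∀ w, w ∈ S' ↔ w⁻¹ ∈ S) :
    MulOpposite.op (hat q Tw S') = hat q (fun w => MulOpposite.op (Tw w⁻¹)) S := by
  rw [hat, hat, Finset.op_sum]
  refine sum_nbij' (fun w => w⁻¹) (fun w => w⁻¹) ?_ ?_ ?_ ?_ ?_ <;> intro w hw <;>
    simp_all [len_inv]

theorem Ehat_eq_oddProd (E : ℕ → A) (f : ℕ) : Ehat E f = BMWRel.oddProd E 0 f := by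
  induction f with
  | zero => simp [Ehat, BMWRel.oddProd]
  | succ f ih =>
    rw [BMWRel.oddProd_succ, ← ih, Ehat, List.range_succ, List.map_append, List.prod_append]
    simp [Ehat]

theorem BMWData.smul_xEl (D : BMWData F A n q r) (hn : 1 ≤ n) {κ : ℕ → F} (hκ₀ : κ 0 = 1)
    (hκ : ∀ f, κ (f + 1) = -((q ^ (2 * f + 2) - 1) * r⁻¹) * κ f) {f : ℕ} (hf : 2 * f ≤ n) :
    κ f • xEl D f = symSum q D.T n 0 * BMWRel.oddProd (fun i => D.T i - q • 1) 0 f *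
      matchings q D.T f n 0 := by
  classical
  have hop := D.isLift.op
  have h := (D.bmwRel hn).op.oddProdRev_mul_symSum (s := 0) (f := f) (m := n - 2 * f) (by omega)
    hκ₀ hκ
  have hfix : ∀ k, ∀ w : Equiv.Perm (Fin n), w ∈ fixSet n k ↔ w⁻¹ ∈ fixSet n k := by
    intro k w
    rw [mem_fixSet, mem_fixSet]
    exact ⟨inv_apply_of_fix, fun hw => by simpa using inv_apply_of_fix hw⟩
  have hsym : ∀ m s, s + m = n → symSum q (fun i => MulOpposite.op (D.T i)) m s =
      MulOpposite.op (hat q D.Tw (fixSet n s)) := fun m s hs => by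
    rw [op_hat_inv _ (hfix s), hop.hat_fixSet hs]
  have hmat : matchings q (fun i => MulOpposite.op (D.T i)) f n 0 =
      MulOpposite.op (hat q D.Tw ((Hset n f).image fun d => d⁻¹)) := by
    rw [op_hat_inv (S := Hset n f) _ fun w => by simp [inv_eq_iff_eq_inv], Hset_eq_shapeSet hf,
      hop.hat_shapeSet f n 0 (by omega)]
  have hodd : BMWRel.oddProdRev (fun i => MulOpposite.op (D.T i) - q • 1) 0 f =
      MulOpposite.op (BMWRel.oddProd (fun i => D.T i - q • 1) 0 f) := by
    rw [BMWRel.op_oddProd]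
    simp
  rw [show 2 * f + (n - 2 * f) = n by omega, zero_add, hmat, hsym n 0 (by omega),
    hsym (n - 2 * f) (2 * f) (by omega), ← BMWRel.op_oddProd, hodd, ← MulOpposite.op_mul,
    ← MulOpposite.op_mul, ← MulOpposite.op_mul, ← MulOpposite.op_smul, MulOpposite.op_inj,
    D.isLift.hat_fixSet (zero_add n)] at h
  rw [h, xEl, Ehat_eq_oddProd, Hset_eq_shapeSet hf, D.isLift.hat_shapeSet f n 0 (by omega),
    ← Hset_eq_shapeSet hf, smul_mul_assoc]
  simp only [mul_assoc]

theorem exists_seq (a : ℕ → F) : ∃ κ : ℕ → F, κ 0 = 1 ∧ ∀ f, κ (f + 1) = a f * κ f :=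
  ⟨fun f => Nat.rec 1 (fun f x => a f * x) f, rfl, fun _ => rfl⟩

theorem den_eq (hq : q ≠ 0) (hr : r ≠ 0) (n f : ℕ) : q ^ (2 * n) - q ^ (2 * f + 3) * r⁻¹ =
    (r * q ^ (2 * (n : ℤ) - 2 * ((f + 1 : ℕ) : ℤ) - 2) - q⁻¹) * (q ^ (2 * f + 4) * r⁻¹) := by
  have h : (q ^ (2 * n) : F) = q ^ (2 * (n : ℤ) - 2 * ((f + 1 : ℕ) : ℤ) - 2) * q ^ (2 * f + 4) := by
    rw [← zpow_natCast, ← zpow_natCast, ← zpow_add₀ hq]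
    congr 1
    push_cast
    ring
  rw [h]
  field_simp
  ring

end Symmetrizer

/-- With `c_0 = 1` and
`c_f = -((q^{4f-3} - q^{2f-3})/(rq^{2n-2f-2} - q⁻¹)) c_{f-1}` (the denominators being
assumed nonzero), the element `x = Σ_{f=0}^{⌊n/2⌋} c_f x_f` satisfies `x E_i = 0` and
`x T_i = q x` for `i = 1, …, n-1`: it is, up to scalars, the symmetrizer. -/
theorem statement18 {F : Type*} [Field F] {A : Type*} [Ring A] [Algebra F A]
    {n : ℕ} (hn : 1 ≤ n) {q r : F} (D : BMWData F A n q r)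
    (hden : ∀ f : ℕ, 1 ≤ f → 2 * f ≤ n →
      r * q ^ (2 * (n : ℤ) - 2 * (f : ℤ) - 2) - q⁻¹ ≠ 0) :
    ∀ i, 1 ≤ i → i ≤ n - 1 →
      (∑ f ∈ Finset.range (n / 2 + 1), cseq q r n f • xEl D f) * D.E i = 0 ∧
      (∑ f ∈ Finset.range (n / 2 + 1), cseq q r n f • xEl D f) * D.T i =
        q • ∑ f ∈ Finset.range (n / 2 + 1), cseq q r n f • xEl D f := by
  intro i hi hi'
  have hq := D.hq
  have hr := D.hr
  have hrel := D.bmwRel hn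
  obtain ⟨κ, hκ₀, hκ⟩ := exists_seq fun f : ℕ => -((q ^ (2 * f + 2) - 1) * r⁻¹)
  obtain ⟨γ, hγ₀, hγ⟩ := exists_seq fun f : ℕ =>
    q ^ (4 * f + 3) / (q ^ (2 * n) - q ^ (2 * f + 3) * r⁻¹)
  have hden' : ∀ f, 2 * (f + 1) ≤ n → q ^ (2 * n) - q ^ (2 * f + 3) * r⁻¹ ≠ 0 := fun f hf => by
    rw [den_eq hq hr]
    exact mul_ne_zero (hden (f + 1) (by omega) hf) (by positivity)
  have hc : ∀ f, 2 * f ≤ n → cseq q r n f = γ f * κ f := by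
    intro f hf
    induction f with
    | zero => rw [cseq, hγ₀, hκ₀, one_mul]
    | succ f ih =>
      have h1 := hden (f + 1) (by omega) hf
      have h2 : q ^ (4 * ((f : ℤ) + 1) - 3) - q ^ (2 * ((f : ℤ) + 1) - 3) =
          (q ^ (2 * f + 2) - 1) * (q ^ (4 * f + 3) / q ^ (2 * f + 4)) := by
        have e1 : q ^ (4 * ((f : ℤ) + 1) - 3) = q ^ (4 * f + 1) := by
          rw [← zpow_natCast]
          congr 1
          push_cast
          ring
        have e2 : q ^ (2 * ((f : ℤ) + 1) - 3) = q ^ (2 * f) / q := by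
          rw [eq_div_iff hq, ← zpow_natCast, ← zpow_add_one₀ hq]
          congr 1
          push_cast
          ring
        rw [e1, e2]
        field_simp
        ring
      rw [cseq, ih (by omega), hγ, hκ, den_eq hq hr, h2]
      push_cast at h1 ⊢
      generalize r * q ^ (2 * (n : ℤ) - 2 * ((f : ℤ) + 1) - 2) - q⁻¹ = c at h1 ⊢
      field_simp
  have hsum : ∑ f ∈ range (n / 2 + 1), cseq q r n f • xEl D f =
      ∑ f ∈ range (n / 2 + 1), γ f • (symSum q D.T n 0 *
        BMWRel.oddProd (fun i => D.T i - q • 1) 0 f * matchings q D.T f n 0) :=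
    sum_congr rfl fun f hf => by
      have hf' : 2 * f ≤ n := by
        rw [mem_range] at hf
        omega
      rw [hc f hf', mul_smul, D.smul_xEl hn hκ₀ hκ hf']
  have hzero := hrel.sum_matchings_mul_sub (γ := γ) rfl hi (by omega)
    (hrel.quasi_symSum (zero_add n)) fun f hf => by
      rw [hγ, div_mul_eq_mul_div, div_mul_cancel₀ _ (hden' f hf), mul_comm]
  rw [← hsum] at hzero
  generalize ∑ f ∈ range (n / 2 + 1), cseq q r n f • xEl D f = x at hzero ⊢
  have hT : x * D.T i = q • x := by
    rwa [mul_sub, mul_smul_comm, mul_one, sub_eq_zero] at hzero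
  refine ⟨?_, hT⟩
  have hTinv : x * D.Tinv i = q⁻¹ • x := by
    rw [eq_inv_smul_iff₀ hq, ← smul_mul_assoc, ← hT, mul_assoc, D.T_mul_Tinv i hi hi', mul_one]
  apply IsSMulRegular.of_ne_zero (M := A) D.hqq
  have h := congrArg (x * ·) (D.skein i hi hi')
  simp only [mul_sub, mul_smul_comm, mul_one, hT, hTinv] at h
  simp only
  linear_combination (norm := module) h

end BMWPaper
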